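/- arXiv:1508.02349 — 2 statements merged into one kernel-verified Lean document; each statement's English description precedes it below -/
import Mathlib

section
/- Let r ≥ 2 and k ≥ 3, and set m = (r−1)k and N = (rk+1)(r−1). If there exists an S_r-equivariant continuous map X → S^{m−1} from the deleted fiber product X of the colorful subcomplex C, then there exists a continuous map f : σ^N → ℝ^{rk} that has no r-Tverberg point. -/
open Set

noncomputable section

/-- The colorful subcomplex `C ⊆ σ^N`: points of the standard simplex on the vertex set
`Fin r × Fin (m+1)` using at most one vertex from each color class `C_j`. -/
def colorfulComplex (r m : ℕ) : Set ((Fin r × Fin (m + 1)) → ℝ) :=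
  {x | x ∈ stdSimplex ℝ (Fin r × Fin (m + 1)) ∧
    ∀ (j : Fin (m + 1)) (i i' : Fin r), 0 < x (i, j) → 0 < x (i', j) → i = i'}

/-- The projection `p : σ^N → σ^m`, `p(x)_j = Σ_i x(i,j)`. -/
def simplexProj (r m : ℕ) (x : (Fin r × Fin (m + 1)) → ℝ) : Fin (m + 1) → ℝ :=
  fun j => ∑ i, x (i, j)

/-- The deleted fiber product `X` of the colorful subcomplex: `r`-tuples of points of `C`
with pairwise disjoint supports and equal projections. -/
def deletedFiberProd (r m : ℕ) : Set (Fin r → ((Fin r × Fin (m + 1)) → ℝ)) :=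
  {x | (∀ i, x i ∈ colorfulComplex r m) ∧
    (Pairwise fun i i' => Disjoint {v | 0 < x i v} {v | 0 < x i' v}) ∧
    (∀ i i', simplexProj r m (x i) = simplexProj r m (x i'))}

/-- The sphere `S^{m-1} = {(z_1,…,z_r) ∈ (ℝ^k)^r : Σ z_i = 0, Σ ‖z_i‖² = 1}`. -/
def blockSphere (k r : ℕ) : Set (Fin r → EuclideanSpace ℝ (Fin k)) :=
  {z | (∑ i, z i) = 0 ∧ (∑ i, ‖z i‖ ^ 2) = 1}

set_option linter.unusedVariables false
set_option linter.deprecated false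

namespace Tv

lemma isClosed_or_le {α : Type*} [TopologicalSpace α] {f g : α → ℝ} (hf : Continuous f)
    (hg : Continuous g) : IsClosed {x | f x ≤ 0 ∨ g x ≤ 0} :=
  (isClosed_le hf continuous_const).union (isClosed_le hg continuous_const)

/-- Support of a point, as a finset. -/
def sp {r m : ℕ} (c : Fin r × Fin (m + 1) → ℝ) : Finset (Fin r × Fin (m + 1)) :=
  Finset.univ.filter fun v => 0 < c v

/-- The point over `y` supported in `D`. -/
def tr {r m : ℕ} (D : Finset (Fin r × Fin (m + 1))) (y : Fin (m + 1) → ℝ) :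
    Fin r × Fin (m + 1) → ℝ := fun v => if v ∈ D then y v.2 else 0

/-- Not all entries are equal. -/
def NV {r : ℕ} {E : Type*} (z : Fin r → E) : Prop := ∃ i j, z i ≠ z j

/-- Colors used. -/
def cs {m : ℕ} (y : Fin (m + 1) → ℝ) : Finset (Fin (m + 1)) :=
  Finset.univ.filter fun j => 0 < y j

variable {r m k : ℕ}

lemma mem_sp {c : Fin r × Fin (m + 1) → ℝ} {v : Fin r × Fin (m + 1)} :
    v ∈ sp c ↔ 0 < c v := by simp [sp]

lemma mem_cs {y : Fin (m + 1) → ℝ} {j : Fin (m + 1)} : j ∈ cs y ↔ 0 < y j := by simp [cs]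

lemma C_nonneg {c : Fin r × Fin (m + 1) → ℝ} (hc : c ∈ colorfulComplex r m) (v) : 0 ≤ c v :=
  hc.1.1 v

lemma C_eq_of_pos {c : Fin r × Fin (m + 1) → ℝ} (hc : c ∈ colorfulComplex r m)
    {i : Fin r} {j : Fin (m + 1)} (h : 0 < c (i, j)) : simplexProj r m c j = c (i, j) := by
  unfold simplexProj
  rw [Finset.sum_eq_single i]
  · intro b _ hb
    by_contra hne
    have : 0 < c (b, j) := lt_of_le_of_ne (C_nonneg hc _) (Ne.symm hne)
    exact hb (hc.2 j b i this h)
  · simp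

lemma C_exists {c : Fin r × Fin (m + 1) → ℝ} (hc : c ∈ colorfulComplex r m)
    {j : Fin (m + 1)} (h : 0 < simplexProj r m c j) : ∃ i, 0 < c (i, j) := by
  by_contra hne
  push Not at hne
  have : simplexProj r m c j ≤ 0 := Finset.sum_nonpos fun i _ => hne i
  linarith

lemma C_proj_mem {c : Fin r × Fin (m + 1) → ℝ} (hc : c ∈ stdSimplex ℝ (Fin r × Fin (m + 1))) :
    simplexProj r m c ∈ stdSimplex ℝ (Fin (m + 1)) := by
  refine ⟨fun j => Finset.sum_nonneg fun i _ => hc.1 _, ?_⟩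
  have := hc.2
  rw [Fintype.sum_prod_type, Finset.sum_comm] at this
  exact this

lemma C_eq_tr {c : Fin r × Fin (m + 1) → ℝ} (hc : c ∈ colorfulComplex r m) :
    c = tr (sp c) (simplexProj r m c) := by
  ext ⟨i, j⟩
  unfold tr
  split_ifs with h
  · exact (C_eq_of_pos hc (mem_sp.1 h)).symm
  · have := C_nonneg hc (i, j)
    rw [mem_sp] at h
    linarith

lemma C_card {c : Fin r × Fin (m + 1) → ℝ} (hc : c ∈ colorfulComplex r m) :
    (sp c).card = (cs (simplexProj r m c)).card := by
  refine Finset.card_bij (fun v _ => v.2) ?_ ?_ ?_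
  · rintro ⟨i, j⟩ h
    rw [mem_cs, C_eq_of_pos hc (mem_sp.1 h)]
    exact mem_sp.1 h
  · rintro ⟨i, j⟩ h ⟨i', j'⟩ h' hh
    simp only at hh
    subst hh
    rw [hc.2 j i i' (mem_sp.1 h) (mem_sp.1 h')]
  · intro j hj
    obtain ⟨i, hi⟩ := C_exists hc (mem_cs.1 hj)
    exact ⟨(i, j), mem_sp.2 hi, rfl⟩

lemma sp_nonempty {c : Fin r × Fin (m + 1) → ℝ} (hc : c ∈ stdSimplex ℝ (Fin r × Fin (m + 1))) :
    (sp c).Nonempty := by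
  by_contra h
  rw [Finset.not_nonempty_iff_eq_empty] at h
  have h2 : ∑ v, c v ≤ 0 := Finset.sum_nonpos fun v _ => by
    by_contra hv
    push Not at hv
    have := mem_sp.2 hv
    simp [h] at this
  have := hc.2
  linarith

/-- Membership from simplex tuples: the pigeonhole argument. -/
lemma mem_X_of_simplex {x : Fin r → Fin r × Fin (m + 1) → ℝ}
    (h1 : ∀ i, x i ∈ stdSimplex ℝ (Fin r × Fin (m + 1)))
    (h2 : Pairwise fun i j => Disjoint {v | 0 < x i v} {v | 0 < x j v})
    (h3 : ∀ i j, simplexProj r m (x i) = simplexProj r m (x j)) : x ∈ deletedFiberProd r m := by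
  refine ⟨fun i => ⟨h1 i, ?_⟩, h2, h3⟩
  intro j a b ha hb
  have hp : ∀ l, 0 < simplexProj r m (x l) j := fun l => by
    rw [h3 l i]
    exact lt_of_lt_of_le ha (Finset.single_le_sum (f := fun i' => x i (i', j))
      (fun i' _ => (h1 i).1 _) (Finset.mem_univ a))
  have hex : ∀ l, ∃ c, 0 < x l (c, j) := fun l => by
    by_contra hne
    push Not at hne
    have : simplexProj r m (x l) j ≤ 0 := Finset.sum_nonpos fun i _ => hne i
    linarith [hp l]
  choose f hf using hex
  have hdis : ∀ l l' c, 0 < x l (c, j) → 0 < x l' (c, j) → l = l' := fun l l' c hl hl' => by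
    by_contra hne
    exact (Set.disjoint_left.1 (h2 hne)) hl hl'
  have aux : ∀ c, 0 < x i (c, j) → c = f i := by
    intro c hc
    have hinj : Function.Injective f := fun l l' h => by
      have h' := hf l'
      rw [← h] at h'
      exact hdis l l' _ (hf l) h'
    obtain ⟨l, hl⟩ := (Finite.injective_iff_surjective.1 hinj) c
    have := hf l
    rw [hl] at this
    rw [← hl, hdis _ _ _ hc this]
  rw [aux a ha, aux b hb]

lemma X_disj {x : Fin r → Fin r × Fin (m + 1) → ℝ} (hx : x ∈ deletedFiberProd r m)
    {l l' : Fin r} {v} (hl : 0 < x l v) (hl' : 0 < x l' v) : l = l' := by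
  by_contra hne
  exact (Set.disjoint_left.1 (hx.2.1 hne)) hl hl'

lemma X_perm {x : Fin r → Fin r × Fin (m + 1) → ℝ} (hx : x ∈ deletedFiberProd r m)
    (π : Equiv.Perm (Fin r)) : (fun i => x (π i)) ∈ deletedFiberProd r m :=
  ⟨fun i => hx.1 _, fun _ _ h => hx.2.1 (fun h' => h (π.injective h')), fun i j => hx.2.2 _ _⟩

lemma X_inj {x : Fin r → Fin r × Fin (m + 1) → ℝ} (hx : x ∈ deletedFiberProd r m) :
    Function.Injective x := by
  intro l l' h
  obtain ⟨v, hv⟩ := sp_nonempty (hx.1 l).1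
  have h1 := mem_sp.1 hv
  have h2 := h1
  rw [h] at h2
  exact X_disj hx h1 h2

lemma X_sum {x : Fin r → Fin r × Fin (m + 1) → ℝ} (hx : x ∈ deletedFiberProd r m) (i0 : Fin r)
    (v : Fin r × Fin (m + 1)) : ∑ i, x i v = simplexProj r m (x i0) v.2 := by
  obtain ⟨c, j⟩ := v
  simp only
  rcases (le_iff_lt_or_eq.1 ((C_proj_mem (hx.1 i0).1).1 j)) with h | h
  · have hex : ∀ l, ∃ c, 0 < x l (c, j) := fun l => C_exists (hx.1 l) (by rwa [hx.2.2 l i0])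
    choose f hf using hex
    have hinj : Function.Injective f := fun l l' h => by
      have h' := hf l'
      rw [← h] at h'
      exact X_disj hx (hf l) h'
    obtain ⟨l, hl⟩ := (Finite.injective_iff_surjective.1 hinj) c
    have hlc := hf l
    rw [hl] at hlc
    rw [Finset.sum_eq_single l, hx.2.2 i0 l, C_eq_of_pos (hx.1 l) hlc]
    · intro b _ hb
      by_contra hne
      exact hb (X_disj hx (lt_of_le_of_ne (C_nonneg (hx.1 b) _) (Ne.symm hne)) hlc)
    · simp
  · rw [← h]
    refine Finset.sum_eq_zero fun i _ => ?_
    by_contra hne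
    have h1 := lt_of_le_of_ne (C_nonneg (hx.1 i) (c, j)) (Ne.symm hne)
    have h2 := C_eq_of_pos (hx.1 i) h1
    rw [hx.2.2 i i0, ← h] at h2
    linarith

/-- If `x'` lies over the same point as `x`, either it is a permutation of `x`, or two of its
entries do not occur in `x`. -/
lemma X_two {x x' : Fin r → Fin r × Fin (m + 1) → ℝ} (hx : x ∈ deletedFiberProd r m)
    (hx' : x' ∈ deletedFiberProd r m) (hp : ∀ i, simplexProj r m (x i) = simplexProj r m (x' i))
    (hn : ¬ ∃ π : Equiv.Perm (Fin r), x' = fun i => x (π i)) :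
    ∃ i j, i ≠ j ∧ x' i ∉ Set.range x ∧ x' j ∉ Set.range x := by
  by_contra hcon
  push Not at hcon
  apply hn
  suffices h : ∀ i, x' i ∈ Set.range x by
    choose f hf using h
    have hinj : Function.Injective f := fun a b hab => X_inj hx' (by rw [← hf a, ← hf b, hab])
    exact ⟨Equiv.ofBijective f (Finite.injective_iff_bijective.1 hinj), by
      ext i : 1; exact (hf i).symm⟩
  intro i
  by_contra hi
  have hother : ∀ j, j ≠ i → x' j ∈ Set.range x := fun j hj => hcon i j hj.symm hi
  choose! f hf using hother
  have hinj : Set.InjOn f (Finset.univ.erase i : Finset (Fin r)) := fun a ha b hb hab => by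
    simp only [Finset.coe_erase, Finset.coe_univ, Set.mem_diff, Set.mem_univ, true_and,
      Set.mem_singleton_iff] at ha hb
    exact X_inj hx' (by rw [← hf a ha, ← hf b hb, hab])
  have hcard : ((Finset.univ.erase i).image f).card < (Finset.univ : Finset (Fin r)).card := by
    rw [Finset.card_image_of_injOn hinj]
    exact Finset.card_erase_lt_of_mem (Finset.mem_univ i)
  obtain ⟨l, -, hl⟩ := Finset.exists_mem_notMem_of_card_lt_card hcard
  have himg : (Finset.univ.erase i).image f = Finset.univ.erase l := by
    apply Finset.eq_of_subset_of_card_le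
    · intro a ha
      rw [Finset.mem_erase]
      exact ⟨fun h => hl (h ▸ ha), Finset.mem_univ _⟩
    · rw [Finset.card_image_of_injOn hinj, Finset.card_erase_of_mem (Finset.mem_univ _),
        Finset.card_erase_of_mem (Finset.mem_univ _)]
  apply hi
  refine ⟨l, ?_⟩
  ext v
  have h1 := X_sum hx i v
  have h2 := X_sum hx' i v
  rw [hp i, ← h2, ← Finset.add_sum_erase _ _ (Finset.mem_univ l),
    ← Finset.add_sum_erase _ (fun i => x' i v) (Finset.mem_univ i), ← himg,
    Finset.sum_image hinj] at h1
  have h3 : ∑ a ∈ Finset.univ.erase i, x (f a) v = ∑ a ∈ Finset.univ.erase i, x' a v :=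
    Finset.sum_congr rfl fun a ha => by rw [hf a (Finset.ne_of_mem_erase ha)]
  linarith

lemma tr_proj {c : Fin r × Fin (m + 1) → ℝ} (hc : c ∈ colorfulComplex r m)
    {y : Fin (m + 1) → ℝ} (hy : y ∈ stdSimplex ℝ (Fin (m + 1)))
    (hs : ∀ j, 0 < y j → 0 < simplexProj r m c j) : simplexProj r m (tr (sp c) y) = y := by
  ext j
  unfold simplexProj tr
  rcases (le_iff_lt_or_eq.1 (hy.1 j)) with h | h
  · obtain ⟨i, hi⟩ := C_exists hc (hs j h)
    rw [Finset.sum_eq_single i]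
    · simp [mem_sp.2 hi]
    · intro b _ hb
      rw [if_neg]
      intro hb'
      exact hb (hc.2 j b i (mem_sp.1 hb') hi)
    · simp
  · simp [← h]

lemma tr_pos {D : Finset (Fin r × Fin (m + 1))} {y : Fin (m + 1) → ℝ} {v}
    (h : 0 < tr D y v) : v ∈ D ∧ 0 < y v.2 := by
  unfold tr at h
  split_ifs at h with h1
  · exact ⟨h1, h⟩
  · exact absurd h (lt_irrefl _)

lemma tr_mem_X {x : Fin r → Fin r × Fin (m + 1) → ℝ} (hx : x ∈ deletedFiberProd r m)
    {y : Fin (m + 1) → ℝ} (hy : y ∈ stdSimplex ℝ (Fin (m + 1)))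
    (hs : ∀ i j, 0 < y j → 0 < simplexProj r m (x i) j) :
    (fun i => tr (sp (x i)) y) ∈ deletedFiberProd r m := by
  have hpr : ∀ i, simplexProj r m (tr (sp (x i)) y) = y := fun i => tr_proj (hx.1 i) hy (hs i)
  refine ⟨fun i => ⟨⟨fun v => ?_, ?_⟩, ?_⟩, ?_, ?_⟩
  · change 0 ≤ tr (sp (x i)) y v
    unfold tr
    split_ifs
    · exact hy.1 _
    · exact le_rfl
  · rw [Fintype.sum_prod_type, Finset.sum_comm]
    have := hy.2
    rw [← hpr i] at this
    exact this
  · intro j a b ha hb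
    exact (hx.1 i).2 j a b (mem_sp.1 (tr_pos ha).1) (mem_sp.1 (tr_pos hb).1)
  · intro i i' h
    rw [Set.disjoint_left]
    intro v h1 h2
    exact h (X_disj hx (mem_sp.1 (tr_pos h1).1) (mem_sp.1 (tr_pos h2).1))
  · intro i i'
    simp only [hpr]

lemma X_card {x : Fin r → Fin r × Fin (m + 1) → ℝ} (hx : x ∈ deletedFiberProd r m) (i j) :
    (sp (x i)).card = (sp (x j)).card := by
  rw [C_card (hx.1 i), C_card (hx.1 j), hx.2.2 i j]

/-- The skeleta. -/
def Cn (r m n : ℕ) : Set (Fin r × Fin (m + 1) → ℝ) :=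
  {c | c ∈ colorfulComplex r m ∧ (sp c).card ≤ n}

def Xn (r m n : ℕ) : Set (Fin r → Fin r × Fin (m + 1) → ℝ) :=
  {x | x ∈ deletedFiberProd r m ∧ ∀ i, (sp (x i)).card ≤ n}

lemma continuous_proj : Continuous (simplexProj r m) := by
  unfold simplexProj
  fun_prop

lemma isClosed_C : IsClosed (colorfulComplex r m) := by
  have : colorfulComplex r m = stdSimplex ℝ (Fin r × Fin (m + 1)) ∩
      ⋂ (j : Fin (m + 1)) (i : Fin r) (i' : Fin r) (_ : i ≠ i'),
        {x : Fin r × Fin (m + 1) → ℝ | x (i, j) ≤ 0 ∨ x (i', j) ≤ 0} := by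
    ext x
    simp only [colorfulComplex, Set.mem_setOf_eq, Set.mem_inter_iff, Set.mem_iInter]
    refine and_congr_right fun _ => forall_congr' fun j => forall_congr' fun i =>
      forall_congr' fun i' => ?_
    constructor
    · intro h hne
      by_contra hcon
      push Not at hcon
      exact hne (h hcon.1 hcon.2)
    · intro h h1 h2
      by_contra hne
      rcases h hne with h | h <;> linarith
  rw [this]
  refine (isClosed_stdSimplex (𝕜 := ℝ) _).inter ?_
  refine isClosed_iInter fun j => isClosed_iInter fun i => isClosed_iInter fun i' =>
    isClosed_iInter fun _ => ?_
  exact isClosed_or_le (f := fun x : Fin r × Fin (m + 1) → ℝ => x (i, j))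
    (g := fun x => x (i', j)) (by fun_prop) (by fun_prop)

lemma isClosed_X : IsClosed (deletedFiberProd r m) := by
  have : deletedFiberProd r m = (⋂ i, {x | x i ∈ colorfulComplex r m}) ∩
      ((⋂ (i : Fin r) (i' : Fin r) (_ : i ≠ i') (v : Fin r × Fin (m + 1)),
        {x : Fin r → Fin r × Fin (m + 1) → ℝ | x i v ≤ 0 ∨ x i' v ≤ 0}) ∩
      (⋂ (i : Fin r) (i' : Fin r), {x | simplexProj r m (x i) = simplexProj r m (x i')})) := by
    ext x
    simp only [deletedFiberProd, Set.mem_setOf_eq, Set.mem_inter_iff, Set.mem_iInter]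
    refine and_congr_right fun _ => and_congr_left fun _ => forall_congr' fun i =>
      forall_congr' fun i' => forall_congr' fun _ => ?_
    beta_reduce
    rw [Set.disjoint_left]
    refine forall_congr' fun v => ?_
    simp only [Set.mem_setOf_eq, not_lt]
    constructor
    · intro h
      by_cases h1 : 0 < x i v
      · exact Or.inr (h h1)
      · exact Or.inl (not_lt.1 h1)
    · rintro (h | h) h1
      · linarith
      · exact h
  rw [this]
  refine (isClosed_iInter fun i => isClosed_C.preimage (continuous_apply i)).inter
    ((isClosed_iInter fun i => isClosed_iInter fun i' => isClosed_iInter fun _ =>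
      isClosed_iInter fun v => ?_).inter (isClosed_iInter fun i => isClosed_iInter fun i' => ?_))
  · exact isClosed_or_le (f := fun x : Fin r → Fin r × Fin (m + 1) → ℝ => x i v)
      (g := fun x => x i' v) (by fun_prop) (by fun_prop)
  · exact isClosed_eq (continuous_proj.comp (continuous_apply _))
      (continuous_proj.comp (continuous_apply _))

lemma isCompact_C : IsCompact (colorfulComplex r m) :=
  (isCompact_stdSimplex ℝ (Fin r × Fin (m + 1))).of_isClosed_subset isClosed_C fun _ h => h.1

lemma isCompact_X : IsCompact (deletedFiberProd r m) :=
  (isCompact_univ_pi fun _ : Fin r => isCompact_C (r := r) (m := m)).of_isClosed_subset isClosed_X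
    fun _ h i _ => h.1 i

lemma isClosed_card (n : ℕ) : IsClosed {c : Fin r × Fin (m + 1) → ℝ | (sp c).card ≤ n} := by
  have : {c : Fin r × Fin (m + 1) → ℝ | (sp c).card ≤ n} =
      ⋂ (D : Finset (Fin r × Fin (m + 1))) (_ : n < D.card), ⋃ v ∈ D, {c | c v ≤ 0} := by
    ext c
    simp only [Set.mem_setOf_eq, Set.mem_iInter, Set.mem_iUnion, exists_prop]
    constructor
    · intro h D hD
      obtain ⟨v, hv, hv'⟩ := Finset.exists_mem_notMem_of_card_lt_card (lt_of_le_of_lt h hD)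
      exact ⟨v, hv, not_lt.1 fun h => hv' (mem_sp.2 h)⟩
    · intro h
      by_contra hcon
      obtain ⟨v, hv, hv'⟩ := h (sp c) (not_le.1 hcon)
      exact absurd (mem_sp.1 hv) (not_lt.2 hv')
  rw [this]
  refine isClosed_iInter fun D => isClosed_iInter fun _ => ?_
  exact Set.Finite.isClosed_biUnion (Finset.finite_toSet D) fun v _ =>
    isClosed_le (by fun_prop) (by fun_prop)

lemma isClosed_Cn (n : ℕ) : IsClosed (Cn r m n) := isClosed_C.inter (isClosed_card n)

lemma isClosed_Xn (n : ℕ) : IsClosed (Xn r m n) := by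
  have : Xn r m n = deletedFiberProd r m ∩ ⋂ i, {x | x i ∈ {c | (sp c).card ≤ n}} := by
    ext x; simp [Xn]
  rw [this]
  exact isClosed_X.inter (isClosed_iInter fun i => (isClosed_card n).preimage (continuous_apply i))

lemma isCompact_Xn (n : ℕ) : IsCompact (Xn r m n) :=
  isCompact_X.of_isClosed_subset (isClosed_Xn n) fun _ h => h.1

lemma Xn_perm {n : ℕ} {x : Fin r → Fin r × Fin (m + 1) → ℝ} (hx : x ∈ Xn r m n)
    (π : Equiv.Perm (Fin r)) : (fun i => x (π i)) ∈ Xn r m n :=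
  ⟨X_perm hx.1 π, fun i => hx.2 _⟩

lemma dim_bound {Ω P : Type*} [Fintype Ω] [NormedAddCommGroup P] [NormedSpace ℝ P]
    [FiniteDimensional ℝ P] (ι : Fin r → Ω) (hι : Function.Injective ι) (Q : Set P)
    (hQ : Convex ℝ Q) (c : Fin r → Ω → P → ℝ) (v : Fin r → P → EuclideanSpace ℝ (Fin k))
    (hc : ∀ l D, ContDiffOn ℝ 1 (c l D) Q) (hv : ∀ l, ContDiffOn ℝ 1 (v l) Q)
    (h1 : ∀ l, ∀ q ∈ Q, c l (ι l) q ≠ 0) (h0 : ∀ l l', l ≠ l' → ∀ q ∈ Q, c l (ι l') q = 0) :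
    dimH {a : Ω → EuclideanSpace ℝ (Fin k) | ∃ q ∈ Q, ∀ l, ∑ D, c l D q • a D = v l q} ≤
      (((Fintype.card Ω - r) * k + Module.finrank ℝ P : ℕ) : ENNReal) := by
  classical
  let I := {D : Ω // D ∉ Set.range ι}
  let Ψ : (I → EuclideanSpace ℝ (Fin k)) × P → Ω → EuclideanSpace ℝ (Fin k) := fun w D =>
    if h : D ∈ Set.range ι then
      (c h.choose (ι h.choose) w.2)⁻¹ • (v h.choose w.2 - ∑ D' : I, c h.choose D'.1 w.2 • w.1 D')
    else w.1 ⟨D, h⟩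
  have hconv : Convex ℝ ((Set.univ : Set (I → EuclideanSpace ℝ (Fin k))) ×ˢ Q) :=
    convex_univ.prod hQ
  have hmaps : Set.MapsTo (Prod.snd : (I → EuclideanSpace ℝ (Fin k)) × P → P)
      (Set.univ ×ˢ Q) Q := fun w hw => hw.2
  have hcomp : ∀ {G : Type} [NormedAddCommGroup G] [NormedSpace ℝ G] (f : P → G),
      ContDiffOn ℝ 1 f Q → ContDiffOn ℝ 1 (fun w : (I → EuclideanSpace ℝ (Fin k)) × P => f w.2)
        (Set.univ ×ˢ Q) := fun f hf => hf.comp contDiff_snd.contDiffOn hmaps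
  have hΨ : ContDiffOn ℝ 1 Ψ (Set.univ ×ˢ Q) := by
    rw [contDiffOn_pi]
    intro D
    by_cases h : D ∈ Set.range ι
    · have : (fun w => Ψ w D) = fun w => (c h.choose (ι h.choose) w.2)⁻¹ •
        (v h.choose w.2 - ∑ D' : I, c h.choose D'.1 w.2 • w.1 D') := by
        ext1 w; simp only [Ψ, dif_pos h]
      rw [this]
      refine ContDiffOn.smul ((hcomp _ (hc _ _)).inv fun w hw => h1 _ _ hw.2) ?_
      refine (hcomp _ (hv _)).sub (ContDiffOn.sum fun D' _ => ?_)
      refine (hcomp _ (hc _ _)).smul (ContDiff.contDiffOn ?_)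
      fun_prop
    · have : (fun w => Ψ w D) = fun w => w.1 ⟨D, h⟩ := by
        ext1 w; simp only [Ψ, dif_neg h]
      rw [this]
      refine ContDiff.contDiffOn ?_
      fun_prop
  have hsub : {a : Ω → EuclideanSpace ℝ (Fin k) | ∃ q ∈ Q, ∀ l, ∑ D, c l D q • a D = v l q} ⊆
      Ψ '' (Set.univ ×ˢ Q) := by
    rintro a ⟨q, hq, hl⟩
    refine ⟨(fun D => a D.1, q), ⟨trivial, hq⟩, ?_⟩
    ext1 D
    by_cases h : D ∈ Set.range ι
    · simp only [Ψ, dif_pos h]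
      have hs := h.choose_spec
      generalize h.choose = l at hs
      have e := hl l
      rw [← Fintype.sum_subtype_add_sum_subtype (fun D => D ∈ Set.range ι)] at e
      rw [Finset.sum_eq_single (⟨ι l, l, rfl⟩ : {D // D ∈ Set.range ι})] at e
      · rw [inv_smul_eq_iff₀ (h1 l q hq), ← e, ← hs, add_sub_assoc]
        simp only [add_eq_left]
        rw [sub_eq_zero]
      · rintro ⟨_, l', rfl⟩ _ hne
        have : l ≠ l' := fun h => hne (by subst h; rfl)
        simp only
        rw [h0 l l' this q hq, zero_smul]
      · intro h
        exact absurd (by simp) h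
    · simp only [Ψ, dif_neg h]
  have hcard : Fintype.card I = Fintype.card Ω - r := by
    rw [Fintype.card_subtype_compl]
    congr 1
    have := Fintype.card_congr (Equiv.ofInjective ι hι)
    rw [Fintype.card_fin] at this
    exact (Fintype.card_congr (Equiv.refl _)).trans this.symm
  calc dimH _ ≤ dimH (Ψ '' (Set.univ ×ˢ Q)) := dimH_mono hsub
    _ ≤ dimH (Set.univ ×ˢ Q : Set ((I → EuclideanSpace ℝ (Fin k)) × P)) :=
        hΨ.dimH_image_le hconv subset_rfl
    _ ≤ dimH (Set.univ : Set ((I → EuclideanSpace ℝ (Fin k)) × P)) := dimH_mono (Set.subset_univ _)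
    _ = _ := by
        rw [Real.dimH_univ_eq_finrank, Module.finrank_prod, Module.finrank_pi_fintype]
        simp [hcard]

lemma exists_smooth_approx {W F : Type*} [NormedAddCommGroup W] [NormedSpace ℝ W]
    [FiniteDimensional ℝ W] [NormedAddCommGroup F] [NormedSpace ℝ F] (f : W → F)
    (hf : Continuous f) (η : ℝ) (hη : 0 < η) :
    ∃ p : W → F, ContDiff ℝ 1 p ∧ ∀ x, dist (p x) (f x) < η := by
  obtain ⟨g, hg⟩ := exists_contMDiffMap_forall_mem_convex_of_local_const (n := 1)
    (modelWithCornersSelf ℝ W) (t := fun x => Metric.ball (f x) η) (fun x => convex_ball _ _) (by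
      intro x
      refine ⟨f x, ?_⟩
      have := hf.continuousAt (x := x) (Metric.ball_mem_nhds (f x) hη)
      filter_upwards [this] with y hy
      rw [Metric.mem_ball, dist_comm]
      exact hy)
  exact ⟨g, g.contMDiff.contDiff, hg⟩

lemma isOpen_NV : IsOpen {z : Fin r → EuclideanSpace ℝ (Fin k) | NV z} := by
  have : {z : Fin r → EuclideanSpace ℝ (Fin k) | NV z} = ⋃ i, ⋃ j, {z | z i ≠ z j} := by
    ext z; simp [NV]
  rw [this]
  exact isOpen_iUnion fun i => isOpen_iUnion fun j =>
    isOpen_ne_fun (continuous_apply _) (continuous_apply _)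

lemma NV_robust {K : Set (Fin r → Fin r × Fin (m + 1) → ℝ)} (hK : IsCompact K)
    {F : (Fin r → Fin r × Fin (m + 1) → ℝ) → Fin r → EuclideanSpace ℝ (Fin k)}
    (hF : Continuous F) (h : ∀ x ∈ K, NV (F x)) :
    ∃ η > 0, ∀ x ∈ K, ∀ z, dist z (F x) < η → NV z := by
  obtain ⟨η, hη, hsub⟩ := (hK.image hF).exists_thickening_subset_open isOpen_NV
    (by rintro _ ⟨x, hx, rfl⟩; exact h x hx)
  exact ⟨η, hη, fun x hx z hz =>
    hsub (Metric.mem_thickening_iff.2 ⟨F x, ⟨x, hx, rfl⟩, hz⟩)⟩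

/-- Straight-line homotopy. -/
def hom (G F : (Fin r → Fin r × Fin (m + 1) → ℝ) → Fin r → EuclideanSpace ℝ (Fin k))
    (x : Fin r → Fin r × Fin (m + 1) → ℝ) (t : ℝ) : Fin r → EuclideanSpace ℝ (Fin k) :=
  (1 - t) • G x + t • F x

def Equi (F : (Fin r → Fin r × Fin (m + 1) → ℝ) → Fin r → EuclideanSpace ℝ (Fin k)) : Prop :=
  ∀ x ∈ deletedFiberProd r m, ∀ π : Equiv.Perm (Fin r), F (fun i => x (π i)) = fun i => F x (π i)

def Zs (G F : (Fin r → Fin r × Fin (m + 1) → ℝ) → Fin r → EuclideanSpace ℝ (Fin k)) :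
    Set (Fin r → Fin r × Fin (m + 1) → ℝ) :=
  {x | x ∈ deletedFiberProd r m ∧ ∃ t ∈ Set.Icc (0 : ℝ) 1, ¬ NV (hom G F x t)}

lemma NV_perm {z : Fin r → EuclideanSpace ℝ (Fin k)} (π : Equiv.Perm (Fin r)) :
    NV (fun i => z (π i)) ↔ NV z := by
  constructor
  · rintro ⟨i, j, h⟩; exact ⟨π i, π j, h⟩
  · rintro ⟨i, j, h⟩; exact ⟨π.symm i, π.symm j, by simpa using h⟩

lemma hom_perm {G F : (Fin r → Fin r × Fin (m + 1) → ℝ) → Fin r → EuclideanSpace ℝ (Fin k)}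
    (hG : Equi G) (hF : Equi F) {x} (hx : x ∈ deletedFiberProd r m) (π : Equiv.Perm (Fin r)) (t) :
    hom G F (fun i => x (π i)) t = fun i => hom G F x t (π i) := by
  unfold hom
  rw [hG x hx π, hF x hx π]
  rfl

lemma Zs_perm {G F : (Fin r → Fin r × Fin (m + 1) → ℝ) → Fin r → EuclideanSpace ℝ (Fin k)}
    (hG : Equi G) (hF : Equi F) {x} (hx : x ∈ Zs G F) (π : Equiv.Perm (Fin r)) :
    (fun i => x (π i)) ∈ Zs G F := by
  obtain ⟨h1, t, ht, h2⟩ := hx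
  refine ⟨X_perm h1 π, t, ht, ?_⟩
  rw [hom_perm hG hF h1, NV_perm]
  exact h2

lemma isClosed_Zs {G F : (Fin r → Fin r × Fin (m + 1) → ℝ) → Fin r → EuclideanSpace ℝ (Fin k)}
    (hG : Continuous G) (hF : Continuous F) : IsClosed (Zs G F) := by
  have hcl : IsClosed {w : (Fin r → Fin r × Fin (m + 1) → ℝ) × ℝ | ¬ NV (hom G F w.1 w.2)} := by
    have hc : Continuous fun w : (Fin r → Fin r × Fin (m + 1) → ℝ) × ℝ => hom G F w.1 w.2 := by
      unfold hom; fun_prop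
    exact (isOpen_NV.preimage hc).isClosed_compl
  have hK : IsCompact ((deletedFiberProd r m ×ˢ Set.Icc (0 : ℝ) 1) ∩
      {w : (Fin r → Fin r × Fin (m + 1) → ℝ) × ℝ | ¬ NV (hom G F w.1 w.2)}) :=
    (isCompact_X.prod isCompact_Icc).inter_right hcl
  have : Zs G F = Prod.fst '' ((deletedFiberProd r m ×ˢ Set.Icc (0 : ℝ) 1) ∩
      {w : (Fin r → Fin r × Fin (m + 1) → ℝ) × ℝ | ¬ NV (hom G F w.1 w.2)}) := by
    ext x
    constructor
    · rintro ⟨h1, t, ht, h2⟩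
      exact ⟨(x, t), ⟨⟨h1, ht⟩, h2⟩, rfl⟩
    · rintro ⟨⟨x, t⟩, ⟨⟨h1, ht⟩, h2⟩, rfl⟩
      exact ⟨h1, t, ht, h2⟩
  rw [this]
  exact (hK.image continuous_fst).isClosed

/-- Homotopy extension for straight-line homotopies. -/
lemma hep {G F : (Fin r → Fin r × Fin (m + 1) → ℝ) → Fin r → EuclideanSpace ℝ (Fin k)}
    (hG : Continuous G) (hF : Continuous F) (eG : Equi G) (eF : Equi F)
    (hNV : ∀ x ∈ deletedFiberProd r m, NV (F x))
    (A : Set (Fin r → Fin r × Fin (m + 1) → ℝ)) (hA : IsClosed A)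
    (pA : ∀ x ∈ A, ∀ π : Equiv.Perm (Fin r), (fun i => x (π i)) ∈ A)
    (hd : Disjoint A (Zs G F)) :
    ∃ F' : (Fin r → Fin r × Fin (m + 1) → ℝ) → Fin r → EuclideanSpace ℝ (Fin k),
      Continuous F' ∧ Equi F' ∧ (∀ x ∈ deletedFiberProd r m, NV (F' x)) ∧ ∀ x ∈ A, F' x = G x := by
  obtain ⟨τ, h0, h1, h01⟩ := exists_continuous_zero_one_of_isClosed hA (isClosed_Zs hG hF) hd
  let N : ℝ := Fintype.card (Equiv.Perm (Fin r))
  have hN : N ≠ 0 := by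
    simp only [N]; exact_mod_cast Fintype.card_ne_zero
  have hNpos : 0 < N := by
    simp only [N]; exact_mod_cast Fintype.card_pos
  let σ : (Fin r → Fin r × Fin (m + 1) → ℝ) → ℝ := fun x =>
    N⁻¹ * ∑ π : Equiv.Perm (Fin r), τ (fun i => x (π i))
  have σc : Continuous σ := by
    simp only [σ]; fun_prop
  have σp : ∀ x (π : Equiv.Perm (Fin r)), σ (fun i => x (π i)) = σ x := by
    intro x π
    simp only [σ]
    congr 1
    exact Fintype.sum_equiv (Equiv.mulLeft π) _ _ fun ρ => rfl
  have σ01 : ∀ x, σ x ∈ Set.Icc (0 : ℝ) 1 := by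
    intro x
    constructor
    · exact mul_nonneg (inv_nonneg.2 hNpos.le) (Finset.sum_nonneg fun π _ => (h01 _).1)
    · have : ∑ π : Equiv.Perm (Fin r), τ (fun i => x (π i)) ≤
          ∑ π : Equiv.Perm (Fin r), (1 : ℝ) := Finset.sum_le_sum fun π _ => (h01 _).2
      simp only [Finset.sum_const, Finset.card_univ, nsmul_eq_mul, mul_one] at this
      simp only [σ]
      rw [inv_mul_le_iff₀ hNpos, mul_one]
      exact this
  refine ⟨fun x => hom G F x (σ x), ?_, ?_, ?_, ?_⟩
  · unfold hom; fun_prop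
  · intro x hx π
    beta_reduce
    rw [hom_perm eG eF hx, σp]
  · intro x hx
    by_cases hZ : x ∈ Zs G F
    · have : σ x = 1 := by
        simp only [σ]
        rw [Finset.sum_congr rfl fun π _ => h1 (Zs_perm eG eF hZ π)]
        simp only [Pi.one_apply, Finset.sum_const, Finset.card_univ, nsmul_eq_mul, mul_one]
        exact inv_mul_cancel₀ hN
      beta_reduce
      rw [this]
      simpa [hom] using hNV x hx
    · by_contra hcon
      exact hZ ⟨hx, σ x, σ01 x, hcon⟩
  · intro x hx
    have : σ x = 0 := by
      simp only [σ]
      rw [Finset.sum_congr rfl fun π _ => h0 (pA x hx π)]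
      simp
    simp [this, hom]

/-- Monomial attached to a set of vertices. -/
def ph (D : Finset (Fin r × Fin (m + 1))) (c : Fin r × Fin (m + 1) → ℝ) : ℝ := ∏ v ∈ D, c v

lemma ph_tr_zero {D D' : Finset (Fin r × Fin (m + 1))} (hc : D.card = D'.card) (hne : D ≠ D')
    (y : Fin (m + 1) → ℝ) : ph D (tr D' y) = 0 := by
  have : ¬ D ⊆ D' := fun h => hne (Finset.eq_of_subset_of_card_le h hc.ge)
  obtain ⟨v, hv, hv'⟩ := Finset.not_subset.1 this
  exact Finset.prod_eq_zero hv (by simp [tr, hv'])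

lemma ph_tr_ne {D : Finset (Fin r × Fin (m + 1))} {y : Fin (m + 1) → ℝ}
    (h : ∀ v ∈ D, 0 < y v.2) : ph D (tr D y) ≠ 0 := by
  refine Finset.prod_ne_zero_iff.2 fun v hv => ?_
  simp only [tr, hv, if_true]
  exact (h v hv).ne'

lemma contDiff_ph (D : Finset (Fin r × Fin (m + 1))) : ContDiff ℝ 1 (ph D) := by
  unfold ph; fun_prop

/-- Affine parametrisation of the hyperplane spanned by the simplex. -/
def Yq (y : Fin m → ℝ) : Fin (m + 1) → ℝ := Fin.cons (1 - ∑ i, y i) y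

lemma contDiff_Yq : ContDiff ℝ 1 (Yq (m := m)) := by
  rw [contDiff_pi]
  intro j
  refine Fin.cases ?_ (fun i => ?_) j
  · simp only [Yq, Fin.cons_zero]; fun_prop
  · simp only [Yq, Fin.cons_succ]; fun_prop

lemma Yq_tail {y : Fin (m + 1) → ℝ} (hy : ∑ j, y j = 1) : Yq (fun i => y i.succ) = y := by
  ext j
  refine Fin.cases ?_ (fun i => ?_) j
  · simp only [Yq, Fin.cons_zero]
    rw [Fin.sum_univ_succ] at hy
    linarith
  · simp only [Yq, Fin.cons_succ]

lemma Yq_comb (a b : ℝ) (hab : a + b = 1) (y y' : Fin m → ℝ) (j : Fin (m + 1)) :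
    Yq (a • y + b • y') j = a * Yq y j + b * Yq y' j := by
  refine Fin.cases ?_ (fun i => ?_) j
  · simp only [Yq, Fin.cons_zero, Pi.add_apply, Pi.smul_apply, smul_eq_mul,
      Finset.sum_add_distrib, ← Finset.mul_sum]
    linear_combination - hab
  · simp [Yq, Fin.cons_succ]

lemma contDiff_tr (D : Finset (Fin r × Fin (m + 1))) : ContDiff ℝ 1 (tr D) := by
  rw [contDiff_pi]
  intro v
  by_cases h : v ∈ D
  · simp only [tr, h, if_true]; fun_prop
  · simp only [tr, h, if_false]; fun_prop

/-- coefficients of the linear system -/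
def cc (i0 i j : Fin r) (W W' : Fin r → Finset (Fin r × Fin (m + 1))) (l : Fin r)
    (D : Finset (Fin r × Fin (m + 1))) (q : (Fin m → ℝ) × ℝ × ℝ) : ℝ :=
  if l = i0 then ph D (tr (W' i) (Yq q.1)) - ph D (tr (W' j) (Yq q.1))
  else ph D (tr (W l) (Yq q.1)) - ph D (tr (W i0) (Yq q.1))

/-- right-hand sides of the linear system -/
def vv (P₀ : (Fin r × Fin (m + 1) → ℝ) → EuclideanSpace ℝ (Fin k))
    (F : (Fin r → Fin r × Fin (m + 1) → ℝ) → Fin r → EuclideanSpace ℝ (Fin k))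
    (i0 i j : Fin r) (W W' : Fin r → Finset (Fin r × Fin (m + 1))) (l : Fin r)
    (q : (Fin m → ℝ) × ℝ × ℝ) : EuclideanSpace ℝ (Fin k) :=
  if l = i0 then P₀ (tr (W' j) (Yq q.1)) - P₀ (tr (W' i) (Yq q.1)) +
      q.2.2 • (F (fun l => tr (W' l) (Yq q.1)) j - F (fun l => tr (W' l) (Yq q.1)) i)
  else P₀ (tr (W i0) (Yq q.1)) - P₀ (tr (W l) (Yq q.1)) +
      q.2.1 • (F (fun l => tr (W l) (Yq q.1)) i0 - F (fun l => tr (W l) (Yq q.1)) l)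

def Bad (P₀ : (Fin r × Fin (m + 1) → ℝ) → EuclideanSpace ℝ (Fin k))
    (F : (Fin r → Fin r × Fin (m + 1) → ℝ) → Fin r → EuclideanSpace ℝ (Fin k))
    (i0 i j : Fin r) (W W' : Fin r → Finset (Fin r × Fin (m + 1))) (S : Finset (Fin (m + 1))) :
    Set (Finset (Fin r × Fin (m + 1)) → EuclideanSpace ℝ (Fin k)) :=
  {a | ∃ q ∈ {q : (Fin m → ℝ) × ℝ × ℝ | ∀ j ∈ S, 0 < Yq q.1 j},
    ∀ l, ∑ D, cc i0 i j W W' l D q • a D = vv P₀ F i0 i j W W' l q}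

lemma contDiff_trY (D : Finset (Fin r × Fin (m + 1))) :
    ContDiff ℝ 1 (fun q : (Fin m → ℝ) × ℝ × ℝ => tr D (Yq q.1)) :=
  (contDiff_tr D).comp (contDiff_Yq.comp contDiff_fst)

lemma Bad_dim {P₀ : (Fin r × Fin (m + 1) → ℝ) → EuclideanSpace ℝ (Fin k)}
    {F : (Fin r → Fin r × Fin (m + 1) → ℝ) → Fin r → EuclideanSpace ℝ (Fin k)}
    (hP : ContDiff ℝ 1 P₀) (hF : ContDiff ℝ 1 F)
    (i0 i j : Fin r) (W W' : Fin r → Finset (Fin r × Fin (m + 1))) (S : Finset (Fin (m + 1)))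
    (n : ℕ) (hW : Function.Injective W) (cW : ∀ l, (W l).card = n) (cW' : ∀ l, (W' l).card = n)
    (sW : ∀ l, ∀ v ∈ W l, v.2 ∈ S) (sW' : ∀ l, ∀ v ∈ W' l, v.2 ∈ S)
    (hi : W' i ∉ Set.range W) (hj : W' j ∉ Set.range W) (hij : W' i ≠ W' j) :
    dimH (Bad P₀ F i0 i j W W' S) ≤
      (((Fintype.card (Finset (Fin r × Fin (m + 1))) - r) * k + (m + 2) : ℕ) : ENNReal) := by
  have hfr : Module.finrank ℝ ((Fin m → ℝ) × ℝ × ℝ) = m + 2 := by simp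
  rw [← hfr]
  have hi' : ∀ l, W' i ≠ W l := fun l h => hi ⟨l, h.symm⟩
  have hj' : ∀ l, W' j ≠ W l := fun l h => hj ⟨l, h.symm⟩
  have hι : ∀ l, l ≠ i0 → Function.update W i0 (W' i) l = W l := fun l hl =>
    Function.update_of_ne hl _ _
  have hι0 : Function.update W i0 (W' i) i0 = W' i := Function.update_self _ _ _
  refine dim_bound (Function.update W i0 (W' i)) ?_ _ ?_ _ _ ?_ ?_ ?_ ?_
  · intro a b hab
    by_cases ha : a = i0 <;> by_cases hb : b = i0
    · rw [ha, hb]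
    · rw [ha, hι0, hι b hb] at hab; exact absurd hab (hi' b)
    · rw [hb, hι0, hι a ha] at hab; exact absurd hab.symm (hi' a)
    · rw [hι a ha, hι b hb] at hab; exact hW hab
  · intro q hq q' hq' a b ha hb hab l hl
    change 0 < Yq (a • q.1 + b • q'.1) l
    rw [Yq_comb a b hab]
    have h1 := hq l hl
    have h2 := hq' l hl
    rcases ha.eq_or_lt with h | h
    · subst h; rw [zero_add] at hab; subst hab; simpa using h2
    · exact add_pos_of_pos_of_nonneg (mul_pos h h1) (mul_nonneg hb h2.le)
  · intro l D
    apply ContDiff.contDiffOn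
    unfold cc
    split_ifs
    · exact ((contDiff_ph D).comp (contDiff_trY _)).sub ((contDiff_ph D).comp (contDiff_trY _))
    · exact ((contDiff_ph D).comp (contDiff_trY _)).sub ((contDiff_ph D).comp (contDiff_trY _))
  · intro l
    apply ContDiff.contDiffOn
    have hFW : ∀ (U : Fin r → Finset (Fin r × Fin (m + 1))) (a : Fin r),
        ContDiff ℝ 1 (fun q : (Fin m → ℝ) × ℝ × ℝ => F (fun l => tr (U l) (Yq q.1)) a) :=
      fun U a => (contDiff_pi.1 hF a).comp (contDiff_pi.2 fun l => contDiff_trY (U l))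
    unfold vv
    split_ifs
    · exact ((hP.comp (contDiff_trY _)).sub (hP.comp (contDiff_trY _))).add
        ((by fun_prop : ContDiff ℝ 1 fun q : (Fin m → ℝ) × ℝ × ℝ => q.2.2).smul
          ((hFW _ _).sub (hFW _ _)))
    · exact ((hP.comp (contDiff_trY _)).sub (hP.comp (contDiff_trY _))).add
        ((by fun_prop : ContDiff ℝ 1 fun q : (Fin m → ℝ) × ℝ × ℝ => q.2.1).smul
          ((hFW _ _).sub (hFW _ _)))
  · intro l q hq
    by_cases hl : l = i0
    · subst hl
      rw [hι0, cc, if_pos rfl, ph_tr_zero (D' := W' j) (by rw [cW', cW']) hij, sub_zero]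
      exact ph_tr_ne fun v hv => hq _ (sW' _ v hv)
    · rw [hι l hl, cc, if_neg hl, ph_tr_zero (D' := W i0) (by rw [cW, cW]) (fun h => hl (hW h)),
        sub_zero]
      exact ph_tr_ne fun v hv => hq _ (sW _ v hv)
  · intro l l' hll q hq
    by_cases hl : l = i0
    · subst hl
      rw [hι l' hll.symm, cc, if_pos rfl, ph_tr_zero (by rw [cW', cW]) (hj' l').symm,
        ph_tr_zero (by rw [cW', cW]) (hi' l').symm, sub_zero]
    · rw [cc, if_neg hl]
      by_cases hl' : l' = i0
      · subst hl'
        rw [hι0, ph_tr_zero (by rw [cW', cW]) (hi' _), ph_tr_zero (by rw [cW', cW]) (hi' _),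
          sub_zero]
      · rw [hι l' hl', ph_tr_zero (by rw [cW, cW]) (fun h => hll (hW h).symm),
          ph_tr_zero (by rw [cW, cW]) (fun h => hl' (hW h)), sub_zero]

def Gen (g : (Fin r × Fin (m + 1) → ℝ) → EuclideanSpace ℝ (Fin k))
    (F : (Fin r → Fin r × Fin (m + 1) → ℝ) → Fin r → EuclideanSpace ℝ (Fin k)) : Prop :=
  ∀ x ∈ deletedFiberProd r m, ∀ x' ∈ deletedFiberProd r m,
    (∀ i, simplexProj r m (x i) = simplexProj r m (x' i)) → ∀ s s' : ℝ, ∀ i j, i ≠ j →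
    x' i ∉ Set.range x → x' j ∉ Set.range x →
    (∀ l l', g (x l) + s • F x l = g (x l') + s • F x l') →
    g (x' i) + s' • F x' i ≠ g (x' j) + s' • F x' j

def gt (P₀ : (Fin r × Fin (m + 1) → ℝ) → EuclideanSpace ℝ (Fin k))
    (a : Finset (Fin r × Fin (m + 1)) → EuclideanSpace ℝ (Fin k)) (c : Fin r × Fin (m + 1) → ℝ) :
    EuclideanSpace ℝ (Fin k) := P₀ c + ∑ D, ph D c • a D

lemma exists_gen (hr : 2 ≤ r) (hk : 3 ≤ k) (hm : m = (r - 1) * k)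
    {P₀ : (Fin r × Fin (m + 1) → ℝ) → EuclideanSpace ℝ (Fin k)}
    {F : (Fin r → Fin r × Fin (m + 1) → ℝ) → Fin r → EuclideanSpace ℝ (Fin k)}
    (hP : ContDiff ℝ 1 P₀) (hF : ContDiff ℝ 1 F) (η : ℝ) (hη : 0 < η) :
    ∃ a : Finset (Fin r × Fin (m + 1)) → EuclideanSpace ℝ (Fin k), dist a 0 < η ∧
      Gen (gt P₀ a) F := by
  let i0 : Fin r := ⟨0, by omega⟩
  let Dat := Fin r × Fin r × (Fin r → Finset (Fin r × Fin (m + 1))) ×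
    (Fin r → Finset (Fin r × Fin (m + 1))) × Finset (Fin (m + 1))
  let Good : Dat → Prop := fun d => Function.Injective d.2.2.1 ∧ (∃ n, (∀ l, (d.2.2.1 l).card = n) ∧
    (∀ l, (d.2.2.2.1 l).card = n)) ∧ (∀ l, ∀ v ∈ d.2.2.1 l, v.2 ∈ d.2.2.2.2) ∧
    (∀ l, ∀ v ∈ d.2.2.2.1 l, v.2 ∈ d.2.2.2.2) ∧ d.2.2.2.1 d.1 ∉ Set.range d.2.2.1 ∧
    d.2.2.2.1 d.2.1 ∉ Set.range d.2.2.1 ∧ d.2.2.2.1 d.1 ≠ d.2.2.2.1 d.2.1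
  let B : Set (Finset (Fin r × Fin (m + 1)) → EuclideanSpace ℝ (Fin k)) :=
    ⋃ d : {d : Dat // Good d}, Bad P₀ F i0 d.1.1 d.1.2.1 d.1.2.2.1 d.1.2.2.2.1 d.1.2.2.2.2
  have hdim : dimH B < Module.finrank ℝ
      (Finset (Fin r × Fin (m + 1)) → EuclideanSpace ℝ (Fin k)) := by
    have hfr : Module.finrank ℝ (Finset (Fin r × Fin (m + 1)) → EuclideanSpace ℝ (Fin k)) =
        Fintype.card (Finset (Fin r × Fin (m + 1))) * k := by
      rw [Module.finrank_pi_fintype]; simp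
    have hcard : r ≤ Fintype.card (Finset (Fin r × Fin (m + 1))) := by
      have : Function.Injective (fun l : Fin r => ({(l, 0)} : Finset (Fin r × Fin (m + 1)))) := by
        intro a b h
        simpa using h
      simpa using Fintype.card_le_of_injective _ this
    have hlt : (Fintype.card (Finset (Fin r × Fin (m + 1))) - r) * k + (m + 2) <
        Fintype.card (Finset (Fin r × Fin (m + 1))) * k := by
      obtain ⟨t, ht⟩ := Nat.exists_eq_add_of_le hcard
      obtain ⟨r', rfl⟩ : ∃ r', r = r' + 1 := ⟨r - 1, by omega⟩
      rw [ht, hm]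
      simp only [Nat.add_sub_cancel_left, Nat.add_sub_cancel]
      ring_nf
      nlinarith
    refine lt_of_le_of_lt ?_ (b := (((Fintype.card (Finset (Fin r × Fin (m + 1))) - r) * k +
      (m + 2) : ℕ) : ENNReal)) ?_
    · rw [dimH_iUnion]
      refine iSup_le fun ⟨d, h1, ⟨n, h2, h3⟩, h4, h5, h6, h7, h8⟩ => ?_
      exact Bad_dim hP hF i0 _ _ _ _ _ n h1 h2 h3 h4 h5 h6 h7 h8
    · rw [hfr]; exact_mod_cast hlt
  have hdense := dense_compl_of_dimH_lt_finrank hdim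
  obtain ⟨a, haB, ha⟩ := hdense.exists_dist_lt 0 hη
  refine ⟨a, by rwa [dist_comm], ?_⟩
  intro x hx x' hx' hp s s' i j hij hi hj hall heq
  apply haB
  let y := simplexProj r m (x i0)
  have hy : y ∈ stdSimplex ℝ (Fin (m + 1)) := C_proj_mem (hx.1 i0).1
  have hxl : ∀ l, tr (sp (x l)) y = x l := fun l => by
    conv_rhs => rw [C_eq_tr (hx.1 l), hx.2.2 l i0]
  have hxl' : ∀ l, tr (sp (x' l)) y = x' l := fun l => by
    conv_rhs => rw [C_eq_tr (hx'.1 l), ← hp, hx.2.2 l i0]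
  have hinj : ∀ {c c' : Fin r × Fin (m + 1) → ℝ}, tr (sp c) y = c → tr (sp c') y = c' →
      sp c = sp c' → c = c' := fun h h' e => by rw [← h, ← h', e]
  have hpos : ∀ {c : Fin r × Fin (m + 1) → ℝ}, tr (sp c) y = c → ∀ v ∈ sp c, v.2 ∈ cs y := by
    intro c h v hv
    rw [mem_cs]
    rw [mem_sp, ← h] at hv
    exact (tr_pos hv).2
  let d : Dat := (i, j, fun l => sp (x l), fun l => sp (x' l), cs y)
  have hd : Good d := by
    refine ⟨fun l l' h => X_inj hx (hinj (hxl l) (hxl l') h),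
      ⟨(cs y).card, fun l => ?_, fun l => ?_⟩, fun l => hpos (hxl l), fun l => hpos (hxl' l),
      ?_, ?_, ?_⟩
    · change (sp (x l)).card = _
      rw [C_card (hx.1 l), hx.2.2 l i0]
    · change (sp (x' l)).card = _
      rw [C_card (hx'.1 l), ← hp, hx.2.2 l i0]
    · rintro ⟨l, hl⟩
      exact hi ⟨l, hinj (hxl l) (hxl' i) hl⟩
    · rintro ⟨l, hl⟩
      exact hj ⟨l, hinj (hxl l) (hxl' j) hl⟩
    · intro h
      exact hij (X_inj hx' (hinj (hxl' i) (hxl' j) h))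
  refine Set.mem_iUnion.2 ⟨⟨d, hd⟩, (fun i => y i.succ, s, s'), ?_, ?_⟩
  · intro j hj
    change 0 < Yq (fun i => y i.succ) j
    rw [Yq_tail hy.2]
    exact mem_cs.1 hj
  · intro l
    simp only [d, cc, vv, Yq_tail hy.2, hxl, hxl']
    split_ifs with hl
    · simp only [sub_smul, Finset.sum_sub_distrib]
      have := heq
      unfold gt at this
      rw [smul_sub]
      have e : ∀ p1 f1 g1 p2 f2 g2 : EuclideanSpace ℝ (Fin k), p1 + f1 + g1 = p2 + f2 + g2 →
        f1 - f2 = p2 - p1 + (g2 - g1) := fun p1 f1 g1 p2 f2 g2 h => by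
          have : p1 + f1 = p2 + f2 + g2 - g1 := eq_sub_of_add_eq h
          have : f1 = p2 + f2 + g2 - g1 - p1 := by rw [← this]; abel
          rw [this]; abel
      exact e _ _ _ _ _ _ this
    · simp only [sub_smul, Finset.sum_sub_distrib]
      have := hall l i0
      unfold gt at this
      rw [smul_sub]
      have e : ∀ p1 f1 g1 p2 f2 g2 : EuclideanSpace ℝ (Fin k), p1 + f1 + g1 = p2 + f2 + g2 →
        f1 - f2 = p2 - p1 + (g2 - g1) := fun p1 f1 g1 p2 f2 g2 h => by
          have : p1 + f1 = p2 + f2 + g2 - g1 := eq_sub_of_add_eq h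
          have : f1 = p2 + f2 + g2 - g1 - p1 := by rw [← this]; abel
          rw [this]; abel
      exact e _ _ _ _ _ _ this

lemma sp_eventually {c : Fin r × Fin (m + 1) → ℝ} {a : ℕ → Fin r × Fin (m + 1) → ℝ}
    (h : Filter.Tendsto a Filter.atTop (nhds c)) (hc : ∀ N, (sp (a N)).card ≤ (sp c).card) :
    ∀ᶠ N in Filter.atTop, sp (a N) = sp c := by
  have h1 : ∀ v : Fin r × Fin (m + 1), ∀ᶠ N in Filter.atTop, v ∈ sp c → v ∈ sp (a N) := by
    intro v
    by_cases hv : v ∈ sp c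
    · have := ((tendsto_pi_nhds.1 h) v).eventually (lt_mem_nhds (mem_sp.1 hv))
      filter_upwards [this] with N hN _ using mem_sp.2 hN
    · exact Filter.Eventually.of_forall fun N h => absurd h hv
  filter_upwards [Filter.eventually_all.2 h1] with N hN
  exact (Finset.eq_of_subset_of_card_le (fun v hv => hN v hv) (hc N)).symm

lemma Zs_s {G F : (Fin r → Fin r × Fin (m + 1) → ℝ) → Fin r → EuclideanSpace ℝ (Fin k)}
    (hNV : ∀ x ∈ deletedFiberProd r m, NV (F x)) {x} (hx : x ∈ Zs G F) :
    ∃ s : ℝ, ∀ l l', G x l + s • F x l = G x l' + s • F x l' := by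
  obtain ⟨h1, t, ht, h2⟩ := hx
  have ht1 : 1 - t ≠ 0 := by
    intro h
    have : t = 1 := by linarith
    subst this
    apply h2
    simpa [hom] using hNV x h1
  refine ⟨t / (1 - t), fun l l' => ?_⟩
  unfold NV at h2
  push Not at h2
  have := h2 l l'
  simp only [hom, Pi.add_apply, Pi.smul_apply] at this
  have h3 := congrArg (fun z => (1 - t)⁻¹ • z) this
  simp only [smul_add, smul_smul, inv_mul_cancel₀ ht1, one_smul] at h3
  rwa [inv_mul_eq_div] at h3

lemma thick {n : ℕ} {g : (Fin r × Fin (m + 1) → ℝ) → EuclideanSpace ℝ (Fin k)}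
    {F : (Fin r → Fin r × Fin (m + 1) → ℝ) → Fin r → EuclideanSpace ℝ (Fin k)}
    (hg : Continuous g) (hF : Continuous F) (hNV : ∀ x ∈ deletedFiberProd r m, NV (F x))
    (hgen : Gen g F) (Z : Set (Fin r → Fin r × Fin (m + 1) → ℝ))
    (hZ : Z = Zs (fun x i => g (x i)) F ∩ Xn r m (n + 1)) (hd : Disjoint Z (Xn r m n)) :
    ∃ ε > 0, Disjoint (Metric.thickening ε Z) (Xn r m n) ∧
      ∀ x ∈ Xn r m (n + 1), x ∈ Metric.thickening ε Z → ∀ x' ∈ Xn r m (n + 1),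
        (∀ i, simplexProj r m (x i) = simplexProj r m (x' i)) →
        (¬ ∃ π : Equiv.Perm (Fin r), x' = fun i => x (π i)) →
        x' ∉ Metric.thickening ε Z ∧
        ∃ i j, i ≠ j ∧ x' i ∉ Set.range x ∧ x' j ∉ Set.range x ∧ g (x' i) ≠ g (x' j) := by
  have hGc : Continuous (fun (x : Fin r → Fin r × Fin (m + 1) → ℝ) i => g (x i)) := by fun_prop
  have hZcl : IsClosed Z := by
    rw [hZ]; exact (isClosed_Zs hGc hF).inter (isClosed_Xn _)
  have hZco : IsCompact Z := by
    rw [hZ]; exact (isCompact_Xn _).inter_left (isClosed_Zs hGc hF)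
  obtain ⟨δ, hδ, hδd⟩ := hd.exists_thickenings hZco (isClosed_Xn n)
  suffices h : ∃ ε > 0, ∀ x ∈ Xn r m (n + 1), x ∈ Metric.thickening ε Z → ∀ x' ∈ Xn r m (n + 1),
        (∀ i, simplexProj r m (x i) = simplexProj r m (x' i)) →
        (¬ ∃ π : Equiv.Perm (Fin r), x' = fun i => x (π i)) →
        x' ∉ Metric.thickening ε Z ∧
        ∃ i j, i ≠ j ∧ x' i ∉ Set.range x ∧ x' j ∉ Set.range x ∧ g (x' i) ≠ g (x' j) by
    obtain ⟨ε, hε, h⟩ := h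
    refine ⟨min δ ε, lt_min hδ hε, ?_, ?_⟩
    · exact hδd.mono (Metric.thickening_mono (min_le_left _ _) _)
        (Metric.self_subset_thickening hδ _)
    · intro x hx hxt x' hx' hp hn
      obtain ⟨h1, h2⟩ := h x hx (Metric.thickening_mono (min_le_right _ _) _ hxt) x' hx' hp hn
      exact ⟨fun h3 => h1 (Metric.thickening_mono (min_le_right _ _) _ h3), h2⟩
  by_contra hcon
  push Not at hcon
  have hcon' : ∀ N : ℕ, ∃ w : (Fin r → Fin r × Fin (m + 1) → ℝ) × (Fin r → Fin r × Fin (m + 1) → ℝ),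
      w.1 ∈ Xn r m (n + 1) ∧ w.1 ∈ Metric.thickening (1 / ((N : ℝ) + 1)) Z ∧
      w.2 ∈ Xn r m (n + 1) ∧ (∀ i, simplexProj r m (w.1 i) = simplexProj r m (w.2 i)) ∧
      (¬ ∃ π : Equiv.Perm (Fin r), w.2 = fun i => w.1 (π i)) ∧
      (w.2 ∉ Metric.thickening (1 / ((N : ℝ) + 1)) Z → ∀ i j, i ≠ j → w.2 i ∉ Set.range w.1 →
        w.2 j ∉ Set.range w.1 → g (w.2 i) = g (w.2 j)) := by
    intro N
    obtain ⟨x, h1, h2, x', h3, h4, h5, h6⟩ := hcon (1 / ((N : ℝ) + 1)) (by positivity)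
    exact ⟨(x, x'), h1, h2, h3, h4, fun ⟨π, hπ⟩ => h5 π hπ, h6⟩
  choose w hw1 hw2 hw3 hw4 hw5 hw6 using hcon'
  obtain ⟨⟨x, x'⟩, ⟨hx, hx'⟩, φ, hφ, hlim⟩ :=
    ((isCompact_Xn (r := r) (m := m) (n + 1)).prod (isCompact_Xn (n + 1))).tendsto_subseq
      (x := w) (fun N => ⟨hw1 N, hw3 N⟩)
  change x ∈ Xn r m (n + 1) at hx
  change x' ∈ Xn r m (n + 1) at hx'
  have la : Filter.Tendsto (fun N => (w (φ N)).1) Filter.atTop (nhds x) :=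
    (continuous_fst.tendsto _).comp hlim
  have lb : Filter.Tendsto (fun N => (w (φ N)).2) Filter.atTop (nhds x') :=
    (continuous_snd.tendsto _).comp hlim
  have leps : Filter.Tendsto (fun N => 1 / ((φ N : ℝ) + 1)) Filter.atTop (nhds 0) :=
    tendsto_one_div_add_atTop_nhds_zero_nat.comp hφ.tendsto_atTop
  -- points outside `Z` are eventually outside of the thickening
  have hout : ∀ (a : ℕ → Fin r → Fin r × Fin (m + 1) → ℝ) (z), Filter.Tendsto a Filter.atTop (nhds z)
      → z ∉ Z → ∀ᶠ N in Filter.atTop, a N ∉ Metric.thickening (1 / ((φ N : ℝ) + 1)) Z := by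
    intro a z ha hz
    obtain ⟨e, he, hball⟩ := Metric.isOpen_iff.1 hZcl.isOpen_compl z hz
    have h1 := (Metric.tendsto_nhds.1 ha) (e / 2) (by positivity)
    have h2 := leps.eventually (gt_mem_nhds (by positivity : (0 : ℝ) < e / 2))
    filter_upwards [h1, h2] with N h1 h2 hmem
    obtain ⟨z', hz', hdz⟩ := Metric.mem_thickening_iff.1 hmem
    refine hball (?_ : z' ∈ Metric.ball z e) hz'
    rw [Metric.mem_ball]
    calc dist z' z ≤ dist (a N) z' + dist (a N) z := dist_triangle_left _ _ _
      _ < e := by linarith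
  have hxZ : x ∈ Z := by
    by_contra hxZ
    obtain ⟨N, hN⟩ := (hout _ x la hxZ).exists
    exact hN (hw2 _)
  have hpx : ∀ i, simplexProj r m (x i) = simplexProj r m (x' i) := by
    intro i
    have h1 : Filter.Tendsto (fun N => simplexProj r m ((w (φ N)).1 i)) Filter.atTop
        (nhds (simplexProj r m (x i))) :=
      (continuous_proj.tendsto _).comp ((tendsto_pi_nhds.1 la) i)
    have h2 : Filter.Tendsto (fun N => simplexProj r m ((w (φ N)).2 i)) Filter.atTop
        (nhds (simplexProj r m (x' i))) :=
      (continuous_proj.tendsto _).comp ((tendsto_pi_nhds.1 lb) i)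
    have h3 : (fun N => simplexProj r m ((w (φ N)).1 i)) =
        fun N => simplexProj r m ((w (φ N)).2 i) := by ext1 N; exact hw4 _ i
    rw [h3] at h1
    exact tendsto_nhds_unique h1 h2
  have hcx : ∀ i, (sp (x i)).card = n + 1 := by
    have hnot : x ∉ Xn r m n := Set.disjoint_left.1 hd hxZ
    have : ∃ i, n < (sp (x i)).card := by
      by_contra h
      push Not at h
      exact hnot ⟨hx.1, h⟩
    obtain ⟨i, hi⟩ := this
    intro j
    have h1 : (sp (x i)).card ≤ n + 1 := hx.2 i
    rw [X_card hx.1 j i]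
    omega
  have hcx' : ∀ i, (sp (x' i)).card = n + 1 := by
    intro i
    rw [C_card (hx'.1.1 i), ← hpx, ← C_card (hx.1.1 i), hcx]
  have ea : ∀ᶠ N in Filter.atTop, ∀ i, sp ((w (φ N)).1 i) = sp (x i) :=
    Filter.eventually_all.2 fun i => sp_eventually ((tendsto_pi_nhds.1 la) i)
      fun N => by rw [hcx]; exact (hw1 _).2 i
  have eb : ∀ᶠ N in Filter.atTop, ∀ i, sp ((w (φ N)).2 i) = sp (x' i) :=
    Filter.eventually_all.2 fun i => sp_eventually ((tendsto_pi_nhds.1 lb) i)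
      fun N => by rw [hcx']; exact (hw3 _).2 i
  -- transfer of equalities
  have htr : ∀ {u v u' v' : Fin r → Fin r × Fin (m + 1) → ℝ}, u ∈ deletedFiberProd r m →
      v ∈ deletedFiberProd r m →
      (∀ i, simplexProj r m (u i) = simplexProj r m (v i)) → (∀ i, sp (u i) = sp (u' i)) →
      (∀ i, sp (v i) = sp (v' i)) → ∀ i l, v' i = u' l → v i = u l := by
    intro u v u' v' hu hv hp h1 h2 i l h
    rw [C_eq_tr (hv.1 i), C_eq_tr (hu.1 l), h2, h1, h, ← hp, hu.2.2 i l]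
  have hnp : ¬ ∃ π : Equiv.Perm (Fin r), x' = fun i => x (π i) := by
    rintro ⟨π, hπ⟩
    obtain ⟨N, h1, h2⟩ := (ea.and eb).exists
    refine hw5 (φ N) ⟨π, ?_⟩
    ext1 i
    exact htr (hw1 _).1 (hw3 _).1 (hw4 _) h1 h2 i (π i) (congrFun hπ i)
  obtain ⟨i, j, hij, hi, hj⟩ := X_two hx.1 hx'.1 hpx hnp
  have hxZs : x ∈ Zs (fun x i => g (x i)) F := by rw [hZ] at hxZ; exact hxZ.1
  obtain ⟨s, hs⟩ := Zs_s hNV hxZs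
  have hG := fun s' => hgen x hx.1 x' hx'.1 hpx s s' i j hij hi hj hs
  have hx'Z : x' ∉ Z := by
    intro h
    rw [hZ] at h
    obtain ⟨s', hs'⟩ := Zs_s hNV h.1
    exact hG s' (hs' i j)
  have hne : g (x' i) ≠ g (x' j) := by
    have := hG 0
    simpa using this
  have ene : ∀ᶠ N in Filter.atTop, g ((w (φ N)).2 i) ≠ g ((w (φ N)).2 j) :=
    lb.eventually (IsOpen.mem_nhds (isOpen_ne_fun (hg.comp (continuous_apply i))
      (hg.comp (continuous_apply j))) hne)
  obtain ⟨N, h1, h2, h3, h4⟩ := (ea.and (eb.and (ene.and (hout _ x' lb hx'Z)))).exists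
  refine h3 (hw6 (φ N) h4 i j hij ?_ ?_)
  · rintro ⟨l, hl⟩
    refine hi ⟨l, htr hx'.1 hx.1 (fun i => (hpx i).symm) (fun i => (h2 i).symm)
      (fun i => (h1 i).symm) l i hl⟩
  · rintro ⟨l, hl⟩
    refine hj ⟨l, htr hx'.1 hx.1 (fun i => (hpx i).symm) (fun i => (h2 i).symm)
      (fun i => (h1 i).symm) l j hl⟩

lemma C_le_one {c : Fin r × Fin (m + 1) → ℝ} (hc : c ∈ colorfulComplex r m) (v) : c v ≤ 1 := by
  rw [← hc.1.2]
  exact Finset.single_le_sum (fun v _ => hc.1.1 v) (Finset.mem_univ v)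

lemma gt_close {P₀ : (Fin r × Fin (m + 1) → ℝ) → EuclideanSpace ℝ (Fin k)}
    {a : Finset (Fin r × Fin (m + 1)) → EuclideanSpace ℝ (Fin k)} {c : Fin r × Fin (m + 1) → ℝ}
    (hc : c ∈ colorfulComplex r m) {e : ℝ} (ha : ∀ D, ‖a D‖ ≤ e) :
    ‖gt P₀ a c - P₀ c‖ ≤ Fintype.card (Finset (Fin r × Fin (m + 1))) * e := by
  unfold gt
  rw [add_sub_cancel_left]
  refine (norm_sum_le _ _).trans ?_
  have : ∀ D ∈ (Finset.univ : Finset (Finset (Fin r × Fin (m + 1)))), ‖ph D c • a D‖ ≤ e := by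
    intro D _
    rw [norm_smul]
    have h1 : ‖ph D c‖ ≤ 1 := by
      unfold ph
      rw [Real.norm_eq_abs, abs_of_nonneg (Finset.prod_nonneg fun v _ => C_nonneg hc v)]
      exact Finset.prod_le_one (fun v _ => C_nonneg hc v) (fun v _ => C_le_one hc v)
    calc ‖ph D c‖ * ‖a D‖ ≤ 1 * ‖a D‖ := mul_le_mul_of_nonneg_right h1 (norm_nonneg _)
      _ ≤ e := by rw [one_mul]; exact ha D
  refine (Finset.sum_le_sum this).trans ?_
  simp

lemma symm_approx (F : (Fin r → Fin r × Fin (m + 1) → ℝ) → Fin r → EuclideanSpace ℝ (Fin k))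
    (hF : Continuous F) (eF : Equi F) (η : ℝ) (hη : 0 < η) :
    ∃ F' : (Fin r → Fin r × Fin (m + 1) → ℝ) → Fin r → EuclideanSpace ℝ (Fin k),
      ContDiff ℝ 1 F' ∧ Equi F' ∧ ∀ x ∈ deletedFiberProd r m, ∀ i, ‖F' x i - F x i‖ ≤ η := by
  obtain ⟨p, hp, hd⟩ := exists_smooth_approx F hF η hη
  let N : ℝ := Fintype.card (Equiv.Perm (Fin r))
  have hNpos : 0 < N := by
    simp only [N]; exact_mod_cast Fintype.card_pos
  refine ⟨fun x i => N⁻¹ • ∑ π : Equiv.Perm (Fin r), p (fun i => x (π i)) (π.symm i), ?_, ?_, ?_⟩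
  · rw [contDiff_pi]
    intro i
    refine ContDiff.const_smul _ (ContDiff.sum fun π _ => ?_)
    refine (contDiff_pi.1 hp _).comp ?_
    rw [contDiff_pi]
    intro j
    fun_prop
  · intro x hx ρ
    ext1 i
    beta_reduce
    congr 1
    exact Fintype.sum_equiv (Equiv.mulLeft ρ) _ _ fun π => by
      have : (Equiv.symm ((Equiv.mulLeft ρ) π)) (ρ i) = π.symm i := by
        rw [Equiv.symm_apply_eq]
        simp
      rw [this]
      rfl
  · intro x hx i
    have h1 : F x i = N⁻¹ • ∑ π : Equiv.Perm (Fin r), F x i := by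
      rw [Finset.sum_const, Finset.card_univ, ← Nat.cast_smul_eq_nsmul ℝ, smul_smul,
        inv_mul_cancel₀ hNpos.ne', one_smul]
    beta_reduce
    rw [h1, ← smul_sub, ← Finset.sum_sub_distrib, norm_smul, Real.norm_eq_abs,
      abs_of_pos (inv_pos.2 hNpos), inv_mul_le_iff₀ hNpos]
    refine (norm_sum_le _ _).trans ?_
    have h2 : ∀ π ∈ (Finset.univ : Finset (Equiv.Perm (Fin r))),
        ‖p (fun i => x (π i)) (π.symm i) - F x i‖ ≤ η := by
      intro π _
      have h3 : F x i = F (fun i => x (π i)) (π.symm i) := by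
        rw [eF x hx π]; simp
      rw [h3, ← dist_eq_norm]
      exact (dist_le_pi_dist _ _ _).trans (hd _).le
    refine (Finset.sum_le_sum h2).trans ?_
    simp [N]

lemma step1 (hr : 2 ≤ r) (hk : 3 ≤ k) (hm : m = (r - 1) * k) {n : ℕ}
    {g : (Fin r × Fin (m + 1) → ℝ) → EuclideanSpace ℝ (Fin k)}
    {F : (Fin r → Fin r × Fin (m + 1) → ℝ) → Fin r → EuclideanSpace ℝ (Fin k)}
    (hg : Continuous g) (hF : Continuous F) (eF : Equi F)
    (hNV : ∀ x ∈ deletedFiberProd r m, NV (F x))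
    (hGF : ∀ x ∈ Xn r m n, F x = fun i => g (x i)) :
    ∃ (g' : (Fin r × Fin (m + 1) → ℝ) → EuclideanSpace ℝ (Fin k))
      (F' : (Fin r → Fin r × Fin (m + 1) → ℝ) → Fin r → EuclideanSpace ℝ (Fin k)),
      Continuous g' ∧ Continuous F' ∧ Equi F' ∧ (∀ x ∈ deletedFiberProd r m, NV (F' x)) ∧
      Gen g' F' ∧ Disjoint (Zs (fun x i => g' (x i)) F') (Xn r m n) := by
  obtain ⟨η, hη, hrob⟩ := NV_robust isCompact_X hF hNV
  have i0 : Fin r := ⟨0, by omega⟩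
  obtain ⟨P₀, hP, hPd⟩ := exists_smooth_approx g hg (η / 4) (by positivity)
  obtain ⟨F', hF', eF', hFd⟩ := symm_approx F hF eF (η / 4) (by positivity)
  let M : ℝ := Fintype.card (Finset (Fin r × Fin (m + 1)))
  have hM : 0 < M := by simp only [M]; exact_mod_cast Fintype.card_pos
  obtain ⟨a, ha, hgen⟩ := exists_gen hr hk hm hP hF' (η / (4 * M)) (by positivity)
  have ha' : ∀ D, ‖a D‖ ≤ η / (4 * M) := fun D => by
    have := (dist_le_pi_dist a 0 D).trans ha.le
    simpa using this
  have hgd : ∀ c ∈ colorfulComplex r m, ‖gt P₀ a c - g c‖ ≤ η / 2 := by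
    intro c hc
    have h1 := gt_close (P₀ := P₀) hc ha'
    have h2 := (hPd c).le
    rw [dist_eq_norm] at h2
    have h3 : (Fintype.card (Finset (Fin r × Fin (m + 1))) : ℝ) * (η / (4 * M)) = η / 4 := by
      change M * (η / (4 * M)) = η / 4
      field_simp
    rw [h3] at h1
    calc ‖gt P₀ a c - g c‖ = ‖(gt P₀ a c - P₀ c) + (P₀ c - g c)‖ := by congr 1; abel
      _ ≤ ‖gt P₀ a c - P₀ c‖ + ‖P₀ c - g c‖ := norm_add_le _ _
      _ ≤ η / 2 := by linarith
  have hFd' : ∀ x ∈ deletedFiberProd r m, ∀ i, ‖F' x i - F x i‖ ≤ η / 2 := fun x hx i =>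
    (hFd x hx i).trans (by linarith)
  refine ⟨gt P₀ a, F', ?_, hF'.continuous, eF', ?_, hgen, ?_⟩
  · have := hP.continuous
    have h2 : ∀ D : Finset (Fin r × Fin (m + 1)), Continuous (ph D) := fun D =>
      (contDiff_ph D).continuous
    unfold gt
    fun_prop
  · intro x hx
    refine hrob x hx _ ?_
    rw [dist_pi_lt_iff hη]
    intro i
    rw [dist_eq_norm]
    linarith [hFd' x hx i]
  · rw [Set.disjoint_left]
    rintro x ⟨hx, t, ht, hZ⟩ hxn
    apply hZ
    refine hrob x hx _ ?_
    rw [dist_pi_lt_iff hη]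
    intro i
    rw [dist_eq_norm]
    have h1 := hFd' x hx i
    have h2 := hgd (x i) (hx.1 i)
    have h3 : g (x i) = F x i := by rw [hGF x hxn]
    rw [h3] at h2
    have e : hom (fun x i => gt P₀ a (x i)) F' x t i - F x i =
        (1 - t) • (gt P₀ a (x i) - F x i) + t • (F' x i - F x i) := by
      simp only [hom, Pi.add_apply, Pi.smul_apply]
      module
    rw [e]
    have h4 : ‖(1 - t) • (gt P₀ a (x i) - F x i)‖ ≤ (1 - t) * (η / 2) := by
      rw [norm_smul, Real.norm_eq_abs, abs_of_nonneg (by linarith [ht.2])]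
      exact mul_le_mul_of_nonneg_left h2 (by linarith [ht.2])
    have h5 : ‖t • (F' x i - F x i)‖ ≤ t * (η / 2) := by
      rw [norm_smul, Real.norm_eq_abs, abs_of_nonneg ht.1]
      exact mul_le_mul_of_nonneg_left h1 ht.1
    have h6 := norm_add_le ((1 - t) • (gt P₀ a (x i) - F x i)) (t • (F' x i - F x i))
    linarith

/-- combinatorial types of top cells -/
def Tt (r m n : ℕ) : Set (Fin r → Finset (Fin r × Fin (m + 1))) :=
  {W | ∃ x ∈ deletedFiberProd r m, (∀ i, W i = sp (x i)) ∧ ∀ i, (W i).card = n + 1}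

def term (δ : (Fin r → Fin r × Fin (m + 1) → ℝ) → Fin r → EuclideanSpace ℝ (Fin k))
    (W : Fin r → Finset (Fin r × Fin (m + 1))) (l : Fin r) (c : Fin r × Fin (m + 1) → ℝ) :
    EuclideanSpace ℝ (Fin k) :=
  if W l ⊆ sp c then δ (fun i => tr (W i) (simplexProj r m c)) l else 0

open Classical in
def Sm (δ : (Fin r → Fin r × Fin (m + 1) → ℝ) → Fin r → EuclideanSpace ℝ (Fin k)) (n : ℕ)
    (c : Fin r × Fin (m + 1) → ℝ) : EuclideanSpace ℝ (Fin k) :=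
  ∑ W ∈ (Finset.univ.filter fun W => W ∈ Tt r m n), ∑ l, term δ W l c

lemma proj_pos {c : Fin r × Fin (m + 1) → ℝ} (hc : c ∈ colorfulComplex r m) {v}
    (h : v ∈ sp c) : 0 < simplexProj r m c v.2 := by
  obtain ⟨i, j⟩ := v
  rw [mem_sp] at h
  rw [C_eq_of_pos hc h]
  exact h

lemma sub_pt {n : ℕ} {x0 : Fin r → Fin r × Fin (m + 1) → ℝ} (hx0 : x0 ∈ deletedFiberProd r m)
    {l : Fin r} {c : Fin r × Fin (m + 1) → ℝ} (hc : c ∈ colorfulComplex r m)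
    (hsub : sp c ⊆ sp (x0 l)) (hn : (sp c).card ≤ n) :
    (fun i => tr (sp (x0 i)) (simplexProj r m c)) ∈ Xn r m n := by
  have hy := C_proj_mem hc.1
  have hs : ∀ i j, 0 < simplexProj r m c j → 0 < simplexProj r m (x0 i) j := by
    intro i j h
    obtain ⟨i', hi'⟩ := C_exists hc h
    have := proj_pos (hx0.1 l) (hsub (mem_sp.2 hi'))
    rwa [hx0.2.2 i l]
  have hX := tr_mem_X hx0 hy hs
  refine ⟨hX, fun i => ?_⟩
  rw [C_card (hX.1 i)]
  change (cs (simplexProj r m (tr (sp (x0 i)) (simplexProj r m c)))).card ≤ n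
  rw [tr_proj (hx0.1 i) hy (hs i), ← C_card hc]
  exact hn

lemma term_pt {n : ℕ} {W : Fin r → Finset (Fin r × Fin (m + 1))} (hW : W ∈ Tt r m n)
    {l : Fin r} {c : Fin r × Fin (m + 1) → ℝ} (hc : c ∈ Cn r m (n + 1)) (hl : W l ⊆ sp c) :
    (fun i => tr (W i) (simplexProj r m c)) ∈ Xn r m (n + 1) ∧
    (∀ i, sp (tr (W i) (simplexProj r m c)) = W i) ∧ tr (W l) (simplexProj r m c) = c := by
  obtain ⟨x0, hx0, hWx, hcard⟩ := hW
  have hWl : W l = sp c := Finset.eq_of_subset_of_card_le hl (by rw [hcard]; exact hc.2)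
  have hWf : W = fun i => sp (x0 i) := funext hWx
  refine ⟨?_, fun i => ?_, ?_⟩
  · have := sub_pt hx0 (l := l) hc.1 (by rw [← hWx, hWl]) hc.2
    rw [hWf]
    exact this
  · ext v
    rw [mem_sp]
    constructor
    · intro h; exact (tr_pos h).1
    · intro h
      have h1 : v ∈ sp (x0 i) := by rw [← hWx]; exact h
      have h2 := proj_pos (hx0.1 i) h1
      rw [hx0.2.2 i l] at h2
      obtain ⟨i', hi'⟩ := C_exists (hx0.1 l) h2
      have h3 : (i', v.2) ∈ sp c := by rw [← hWl, hWx]; exact mem_sp.2 hi'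
      have h4 := proj_pos hc.1 h3
      simpa [tr, h] using h4
  · rw [hWl]; exact (C_eq_tr hc.1).symm

lemma Sm_ne {n : ℕ}
    {δ : (Fin r → Fin r × Fin (m + 1) → ℝ) → Fin r → EuclideanSpace ℝ (Fin k)}
    {U : Set (Fin r → Fin r × Fin (m + 1) → ℝ)} (hδ : ∀ x ∈ Xn r m (n + 1), x ∉ U → δ x = 0)
    {c : Fin r × Fin (m + 1) → ℝ} (hc : c ∈ Cn r m (n + 1)) (h : Sm δ n c ≠ 0) :
    ∃ x ∈ Xn r m (n + 1), x ∈ U ∧ ∃ l, x l = c := by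
  classical
  unfold Sm at h
  obtain ⟨W, hW, h1⟩ := Finset.exists_ne_zero_of_sum_ne_zero h
  obtain ⟨l, _, h2⟩ := Finset.exists_ne_zero_of_sum_ne_zero h1
  have hW' : W ∈ Tt r m n := (Finset.mem_filter.1 hW).2
  unfold term at h2
  split_ifs at h2 with hl
  · obtain ⟨p1, p2, p3⟩ := term_pt hW' hc hl
    refine ⟨_, p1, ?_, l, p3⟩
    by_contra hU
    apply h2
    rw [hδ _ p1 hU]
    rfl
  · exact absurd rfl h2

lemma Sm_eq {n : ℕ}
    {δ : (Fin r → Fin r × Fin (m + 1) → ℝ) → Fin r → EuclideanSpace ℝ (Fin k)} (eδ : Equi δ)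
    {U : Set (Fin r → Fin r × Fin (m + 1) → ℝ)} (hδ : ∀ x ∈ Xn r m (n + 1), x ∉ U → δ x = 0)
    {x : Fin r → Fin r × Fin (m + 1) → ℝ} (hx : x ∈ Xn r m (n + 1))
    (hcard : ∀ i, (sp (x i)).card = n + 1)
    (huniq : ∀ x' ∈ Xn r m (n + 1), x' ∈ U →
      (∀ i, simplexProj r m (x i) = simplexProj r m (x' i)) →
      ∃ π : Equiv.Perm (Fin r), x' = fun i => x (π i)) (i : Fin r) :
    Sm δ n (x i) = (Fintype.card (Equiv.Perm (Fin r)) : ℝ) • δ x i := by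
  classical
  have hspinj : ∀ a b, sp (x a) = sp (x b) → a = b := by
    intro a b h
    apply X_inj hx.1
    rw [C_eq_tr (hx.1.1 a), C_eq_tr (hx.1.1 b), h, hx.1.2.2 a b]
  have hCn : ∀ i, x i ∈ Cn r m (n + 1) := fun i => ⟨hx.1.1 i, hx.2 i⟩
  let J : Equiv.Perm (Fin r) → Fin r → Finset (Fin r × Fin (m + 1)) := fun π l => sp (x (π l))
  have hJ : Function.Injective J := by
    intro π ρ h
    ext1 l
    exact hspinj _ _ (congrFun h l)
  have hJT : ∀ π, J π ∈ Tt r m n := fun π =>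
    ⟨_, X_perm hx.1 π, fun i => rfl, fun i => hcard _⟩
  have hterm : ∀ π l, term δ (J π) l (x i) = if π l = i then δ x i else 0 := by
    intro π l
    unfold term
    by_cases h : π l = i
    · have hs : J π l ⊆ sp (x i) := by simp only [J, h]; exact subset_rfl
      rw [if_pos hs, if_pos h]
      have : (fun l => tr (J π l) (simplexProj r m (x i))) = fun l => x (π l) := by
        ext1 l
        simp only [J]
        rw [hx.1.2.2 i (π l)]
        exact (C_eq_tr (hx.1.1 _)).symm
      rw [this, eδ x hx.1 π, ← h]
    · rw [if_neg h, if_neg]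
      intro hs
      exact h (hspinj _ _ (Finset.eq_of_subset_of_card_le hs ((hcard i).le.trans (hcard (π l)).ge)))
  have h1 : Sm δ n (x i) = ∑ W ∈ Finset.univ.image J, ∑ l, term δ W l (x i) := by
    unfold Sm
    symm
    apply Finset.sum_subset
    · intro W hW
      obtain ⟨π, _, rfl⟩ := Finset.mem_image.1 hW
      exact Finset.mem_filter.2 ⟨Finset.mem_univ _, hJT π⟩
    · intro W hW hnW
      have hW' : W ∈ Tt r m n := (Finset.mem_filter.1 hW).2
      refine Finset.sum_eq_zero fun l _ => ?_
      unfold term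
      split_ifs with hl
      · obtain ⟨p1, p2, p3⟩ := term_pt hW' (hCn i) hl
        by_cases hU : (fun i' => tr (W i') (simplexProj r m (x i))) ∈ U
        · exfalso
          apply hnW
          have hp : ∀ i', simplexProj r m (x i') =
              simplexProj r m (tr (W i') (simplexProj r m (x i))) := by
            intro i'
            have := p1.1.2.2 i' l
            beta_reduce at this
            rw [this, p3]
            exact hx.1.2.2 _ _
          obtain ⟨π, hπ⟩ := huniq _ p1 hU hp
          refine Finset.mem_image.2 ⟨π, Finset.mem_univ _, ?_⟩
          ext1 l'
          rw [← p2 l']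
          simp only [J]
          rw [← congrFun hπ l']
        · rw [hδ _ p1 hU]; rfl
      · rfl
  rw [h1, Finset.sum_image (fun a _ b _ h => hJ h)]
  have h2 : ∀ π : Equiv.Perm (Fin r), ∑ l, term δ (J π) l (x i) = δ x i := by
    intro π
    rw [Finset.sum_congr rfl fun l _ => hterm π l]
    rw [Finset.sum_eq_single (π.symm i)]
    · simp
    · intro b _ hb
      rw [if_neg]
      intro h
      apply hb
      rw [← h]; simp
    · intro h; exact absurd (Finset.mem_univ _) h
  rw [Finset.sum_congr rfl fun π _ => h2 π, Finset.sum_const, Finset.card_univ,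
    Nat.cast_smul_eq_nsmul]

lemma Sm_cont {n : ℕ}
    {δ : (Fin r → Fin r × Fin (m + 1) → ℝ) → Fin r → EuclideanSpace ℝ (Fin k)}
    (cδ : Continuous δ) (hδ : ∀ x ∈ Xn r m n, δ x = 0) :
    ContinuousOn (Sm δ n) (Cn r m (n + 1)) := by
  classical
  unfold Sm
  refine continuousOn_finset_sum _ fun W hW => continuousOn_finset_sum _ fun l _ => ?_
  obtain ⟨x0, hx0, hWx, hcard⟩ := (Finset.mem_filter.1 hW).2
  have hWf : W = fun i => sp (x0 i) := funext hWx
  let A : Set (Fin r × Fin (m + 1) → ℝ) := {c | ∃ v ∈ W l, c v ≤ 0}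
  let B : Set (Fin r × Fin (m + 1) → ℝ) := {c | ∀ v, v ∉ W l → c v ≤ 0}
  have hA : IsClosed A := by
    have : A = ⋃ v ∈ W l, {c | c v ≤ 0} := by ext c; simp [A]
    rw [this]
    exact isClosed_biUnion_finset fun v _ => isClosed_le (continuous_apply v) continuous_const
  have hB : IsClosed B := by
    have : B = ⋂ (v) (_ : v ∉ W l), {c | c v ≤ 0} := by ext c; simp [B]
    rw [this]
    exact isClosed_iInter fun v => isClosed_iInter fun _ =>
      isClosed_le (continuous_apply v) continuous_const
  have mA : ∀ c, c ∈ A ↔ ¬ W l ⊆ sp c := by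
    intro c
    rw [Finset.not_subset]
    refine exists_congr fun v => and_congr_right fun _ => ?_
    rw [mem_sp, not_lt]
  have mB : ∀ c, c ∈ B ↔ sp c ⊆ W l := by
    intro c
    constructor
    · intro h v hv
      by_contra hvW
      exact absurd (mem_sp.1 hv) (not_lt.2 (h v hvW))
    · intro h v hv
      by_contra hvc
      exact hv (h (mem_sp.2 (not_le.1 hvc)))
  have hcov : Cn r m (n + 1) = (Cn r m (n + 1) ∩ A) ∪ (Cn r m (n + 1) ∩ B) := by
    rw [← Set.inter_union_distrib_left]
    refine (Set.inter_eq_left.2 fun c hc => ?_).symm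
    by_cases h : W l ⊆ sp c
    · right
      rw [mB, Finset.eq_of_subset_of_card_le h (by rw [hcard]; exact hc.2)]
    · left; exact (mA c).2 h
  rw [hcov]
  refine ContinuousOn.union_of_isClosed ?_ ?_ ((isClosed_Cn _).inter hA) ((isClosed_Cn _).inter hB)
  · refine (continuousOn_const (c := (0 : EuclideanSpace ℝ (Fin k)))).congr ?_
    intro c hc
    exact if_neg ((mA c).1 hc.2)
  · have hcont : Continuous fun c : Fin r × Fin (m + 1) → ℝ =>
        δ (fun i => tr (W i) (simplexProj r m c)) l := by
      refine (continuous_apply l).comp (cδ.comp (continuous_pi fun i => ?_))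
      exact (contDiff_tr (W i)).continuous.comp continuous_proj
    refine hcont.continuousOn.congr ?_
    intro c hc
    change (if W l ⊆ sp c then _ else _) = _
    split_ifs with h
    · rfl
    · have hlt : (sp c).card ≤ n := by
        have hss : sp c ⊂ W l := ⟨(mB c).1 hc.2, h⟩
        have := Finset.card_lt_card hss
        rw [hcard] at this
        omega
      have := sub_pt hx0 (l := l) hc.1.1 (by rw [← hWx]; exact (mB c).1 hc.2) hlt
      rw [hWf]
      beta_reduce
      rw [hδ _ this]
      rfl

lemma exists_ext {α : Type*} [TopologicalSpace α] [NormalSpace α] {ι : Type*} [Fintype ι]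
    {K : Set α} (hK : IsClosed K) {f : α → EuclideanSpace ℝ ι} (hf : ContinuousOn f K) :
    ∃ f' : α → EuclideanSpace ℝ ι, Continuous f' ∧ ∀ x ∈ K, f' x = f x := by
  obtain ⟨F, hF⟩ := ContinuousMap.exists_restrict_eq hK
    (⟨K.restrict f, continuousOn_iff_continuous_restrict.1 hf⟩ : C(K, EuclideanSpace ℝ ι))
  refine ⟨F, F.continuous, fun x hx => ?_⟩
  have := congrArg (fun h => h ⟨x, hx⟩) hF
  exact this

def Pn (r m k n : ℕ) : Prop :=
  ∃ (g : (Fin r × Fin (m + 1) → ℝ) → EuclideanSpace ℝ (Fin k))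
    (F : (Fin r → Fin r × Fin (m + 1) → ℝ) → Fin r → EuclideanSpace ℝ (Fin k)),
    Continuous g ∧ Continuous F ∧ Equi F ∧ (∀ x ∈ deletedFiberProd r m, NV (F x)) ∧
      ∀ x ∈ Xn r m n, F x = fun i => g (x i)

lemma thick_perm {Z : Set (Fin r → Fin r × Fin (m + 1) → ℝ)}
    (hZ : ∀ x ∈ Z, ∀ π : Equiv.Perm (Fin r), (fun i => x (π i)) ∈ Z) {ε : ℝ}
    {x : Fin r → Fin r × Fin (m + 1) → ℝ} (hx : x ∈ Metric.thickening ε Z)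
    (π : Equiv.Perm (Fin r)) : (fun i => x (π i)) ∈ Metric.thickening ε Z := by
  obtain ⟨z, hz, hd⟩ := Metric.mem_thickening_iff.1 hx
  refine Metric.mem_thickening_iff.2 ⟨_, hZ z hz π, lt_of_le_of_lt ?_ hd⟩
  exact (dist_pi_le_iff dist_nonneg).2 fun i => dist_le_pi_dist x z (π i)

lemma step (hr : 2 ≤ r) (hk : 3 ≤ k) (hm : m = (r - 1) * k) {n : ℕ} (h : Pn r m k n) :
    Pn r m k (n + 1) := by
  obtain ⟨g0, F0, hg0, hF0, eF0, nF0, hgF0⟩ := h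
  obtain ⟨g, F, hg, hF, eF, nF, hgen, hdis⟩ := step1 hr hk hm hg0 hF0 eF0 nF0 hgF0
  let G : (Fin r → Fin r × Fin (m + 1) → ℝ) → Fin r → EuclideanSpace ℝ (Fin k) :=
    fun x i => g (x i)
  have cG : Continuous G := by simp only [G]; fun_prop
  have eG : Equi G := fun x _ π => rfl
  let Z := Zs G F ∩ Xn r m (n + 1)
  have pZ : ∀ x ∈ Z, ∀ π : Equiv.Perm (Fin r), (fun i => x (π i)) ∈ Z := fun x hx π =>
    ⟨Zs_perm eG eF hx.1 π, Xn_perm hx.2 π⟩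
  obtain ⟨ε, hε, hεd, hth⟩ := thick hg hF nF hgen Z rfl (hdis.mono_left fun x hx => hx.1)
  let A := Xn r m (n + 1) \ Metric.thickening ε Z
  have hAcl : IsClosed A := (isClosed_Xn _).sdiff Metric.isOpen_thickening
  have hAp : ∀ x ∈ A, ∀ π : Equiv.Perm (Fin r), (fun i => x (π i)) ∈ A := by
    intro x hx π
    refine ⟨Xn_perm hx.1 π, fun h => hx.2 ?_⟩
    have := thick_perm pZ h π.symm
    simpa using this
  have hAd : Disjoint A (Zs G F) := by
    rw [Set.disjoint_left]
    intro x hx hxZ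
    exact hx.2 (Metric.self_subset_thickening hε _ ⟨hxZ, hx.1⟩)
  obtain ⟨F1, cF1, eF1, nF1, hF1⟩ := hep cG hF eG eF nF A hAcl hAp hAd
  have hXsub : ∀ x ∈ Xn r m n, x ∈ A := fun x hx =>
    ⟨⟨hx.1, fun i => (hx.2 i).trans (Nat.le_succ n)⟩, fun h => Set.disjoint_left.1 hεd h hx⟩
  let δ : (Fin r → Fin r × Fin (m + 1) → ℝ) → Fin r → EuclideanSpace ℝ (Fin k) :=
    fun x => F1 x - G x
  have cδ : Continuous δ := cF1.sub cG
  have eδ : Equi δ := by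
    intro x hx π
    simp only [δ]
    rw [eF1 x hx π, eG x hx π]
    rfl
  have hδU : ∀ x ∈ Xn r m (n + 1), x ∉ Metric.thickening ε Z → δ x = 0 := by
    intro x hx hU
    simp only [δ]
    rw [hF1 x ⟨hx, hU⟩, sub_self]
  have hδn : ∀ x ∈ Xn r m n, δ x = 0 := by
    intro x hx
    simp only [δ]
    rw [hF1 x (hXsub x hx), sub_self]
  let N : ℝ := Fintype.card (Equiv.Perm (Fin r))
  have hN : N ≠ 0 := by
    simp only [N]; exact_mod_cast Fintype.card_ne_zero
  have hcont : ContinuousOn (fun c => g c + N⁻¹ • Sm δ n c) (Cn r m (n + 1)) :=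
    hg.continuousOn.add ((Sm_cont cδ hδn).const_smul N⁻¹)
  obtain ⟨g', cg', hg'⟩ := exists_ext (isClosed_Cn (n + 1)) hcont
  let G' : (Fin r → Fin r × Fin (m + 1) → ℝ) → Fin r → EuclideanSpace ℝ (Fin k) :=
    fun x i => g' (x i)
  have cG' : Continuous G' := by simp only [G']; fun_prop
  have eG' : Equi G' := fun x _ π => rfl
  have hCn : ∀ x ∈ Xn r m (n + 1), ∀ i, x i ∈ Cn r m (n + 1) := fun x hx i =>
    ⟨hx.1.1 i, hx.2 i⟩
  have hS0 : ∀ c ∈ Cn r m (n + 1), Sm δ n c = 0 → g' c = g c := by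
    intro c hc h
    rw [hg' c hc, h, smul_zero, add_zero]
  have hU : ∀ x ∈ Xn r m (n + 1), x ∈ Metric.thickening ε Z → G' x = F1 x := by
    intro x hx hxU
    have hcx : ∀ i, (sp (x i)).card = n + 1 := by
      have hnot : x ∉ Xn r m n := Set.disjoint_left.1 hεd hxU
      have : ∃ i, n < (sp (x i)).card := by
        by_contra h
        push Not at h
        exact hnot ⟨hx.1, h⟩
      obtain ⟨i, hi⟩ := this
      intro j
      have h1 : (sp (x i)).card ≤ n + 1 := hx.2 i
      rw [X_card hx.1 j i]
      omega
    ext1 i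
    have := Sm_eq eδ hδU hx hcx (fun x' hx' hU' hp => by
      by_contra hcon
      exact (hth x hx hxU x' hx' hp hcon).1 hU') i
    change g' (x i) = F1 x i
    rw [hg' _ (hCn x hx i)]
    beta_reduce
    rw [this, smul_smul, inv_mul_cancel₀ hN, one_smul]
    simp only [δ, G, Pi.sub_apply]
    abel
  have hnU : ∀ x ∈ Xn r m (n + 1), x ∉ Metric.thickening ε Z →
      ∃ i j, g' (x i) = g (x i) ∧ g' (x j) = g (x j) ∧ g (x i) ≠ g (x j) := by
    intro x hx hxU
    by_cases hall : ∀ i, Sm δ n (x i) = 0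
    · obtain ⟨i, j, hij⟩ := nF1 x hx.1
      rw [hF1 x ⟨hx, hxU⟩] at hij
      exact ⟨i, j, hS0 _ (hCn x hx i) (hall i), hS0 _ (hCn x hx j) (hall j), hij⟩
    · push Not at hall
      obtain ⟨i1, hi1⟩ := hall
      have getU : ∀ i, Sm δ n (x i) ≠ 0 → ∃ x' ∈ Xn r m (n + 1), x' ∈ Metric.thickening ε Z ∧
          (∃ l, x' l = x i) ∧ ∀ a b, simplexProj r m (x' a) = simplexProj r m (x b) := by
        intro i hi
        obtain ⟨x', h1, h2, l, h3⟩ := Sm_ne hδU (hCn x hx i) hi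
        refine ⟨x', h1, h2, ⟨l, h3⟩, fun a b => ?_⟩
        rw [h1.1.2.2 a l, h3, hx.1.2.2 i b]
      obtain ⟨x2, h1, h2, _, hp2⟩ := getU i1 hi1
      have hnp : ¬ ∃ π : Equiv.Perm (Fin r), x = fun i => x2 (π i) := by
        rintro ⟨π, hπ⟩
        apply hxU
        rw [hπ]
        exact thick_perm pZ h2 π
      obtain ⟨-, i, j, hij, hi, hj, hne⟩ := hth x2 h1 h2 x hx (fun i => hp2 i i) hnp
      have hz : ∀ i, x i ∉ Set.range x2 → Sm δ n (x i) = 0 := by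
        intro i hi
        by_contra hcon
        obtain ⟨x3, h3, h4, ⟨l, hl⟩, hp3⟩ := getU i hcon
        have : ∃ π : Equiv.Perm (Fin r), x3 = fun i => x2 (π i) := by
          by_contra hc
          exact (hth x2 h1 h2 x3 h3 (fun i => (hp2 i i).trans (hp3 i i).symm) hc).1 h4
        obtain ⟨π, hπ⟩ := this
        apply hi
        rw [← hl, hπ]
        exact ⟨π l, rfl⟩
      exact ⟨i, j, hS0 _ (hCn x hx i) (hz i hi), hS0 _ (hCn x hx j) (hz j hj), hne⟩
  have hfin : Disjoint (Xn r m (n + 1)) (Zs G' F1) := by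
    rw [Set.disjoint_left]
    rintro x hx ⟨hxX, t, ht, hnv⟩
    apply hnv
    by_cases hxU : x ∈ Metric.thickening ε Z
    · have : hom G' F1 x t = F1 x := by
        unfold hom
        rw [hU x hx hxU]
        module
      rw [this]
      exact nF1 x hxX
    · obtain ⟨i, j, hi, hj, hij⟩ := hnU x hx hxU
      have key : ∀ i, g' (x i) = g (x i) → hom G' F1 x t i = g (x i) := by
        intro i hi
        unfold hom
        rw [hF1 x ⟨hx, hxU⟩]
        change (1 - t) • g' (x i) + t • g (x i) = g (x i)
        rw [hi]
        module
      refine ⟨i, j, ?_⟩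
      rw [key i hi, key j hj]
      exact hij
  obtain ⟨F2, cF2, eF2, nF2, hF2⟩ := hep cG' cF1 eG' eF1 nF1 (Xn r m (n + 1)) (isClosed_Xn _)
    (fun x hx π => Xn_perm hx π) hfin
  exact ⟨g', F2, cg', cF2, eF2, nF2, hF2⟩

lemma main (hr : 2 ≤ r) (hk : 3 ≤ k) (hm : m = (r - 1) * k)
    {F : (Fin r → Fin r × Fin (m + 1) → ℝ) → Fin r → EuclideanSpace ℝ (Fin k)}
    (hF : ContinuousOn F (deletedFiberProd r m))
    (hmap : Set.MapsTo F (deletedFiberProd r m) (blockSphere k r))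
    (eF : Equi F) :
    ∃ g : (Fin r × Fin (m + 1) → ℝ) → EuclideanSpace ℝ (Fin k), Continuous g ∧
      ∀ x ∈ deletedFiberProd r m, NV fun i => g (x i) := by
  have hr0 : 0 < r := by omega
  have h0 : Pn r m k 0 := by
    have hext : ∀ i, ∃ f' : (Fin r → Fin r × Fin (m + 1) → ℝ) → EuclideanSpace ℝ (Fin k),
        Continuous f' ∧ ∀ x ∈ deletedFiberProd r m, f' x = F x i := fun i =>
      exists_ext isClosed_X (f := fun x => F x i) ((continuous_apply i).comp_continuousOn hF)
    choose f' cf' hf' using hext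
    have heq : ∀ x ∈ deletedFiberProd r m, (fun i => f' i x) = F x := fun x hx =>
      funext fun i => hf' i x hx
    refine ⟨fun _ => 0, fun x i => f' i x, continuous_const, continuous_pi cf', ?_, ?_, ?_⟩
    · intro x hx π
      beta_reduce
      rw [heq _ (X_perm hx π), eF x hx π]
      ext1 i
      rw [← heq x hx]
    · intro x hx
      beta_reduce
      rw [heq x hx]
      by_contra hnv
      unfold NV at hnv
      push Not at hnv
      obtain ⟨hs, hn⟩ := hmap hx
      have hc : ∀ i, F x i = 0 := by
        intro i
        rw [Finset.sum_congr rfl fun j _ => hnv j i, Finset.sum_const, Finset.card_univ,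
          Fintype.card_fin, ← Nat.cast_smul_eq_nsmul ℝ] at hs
        exact (smul_eq_zero.1 hs).resolve_left (by exact_mod_cast hr0.ne')
      simp [hc] at hn
    · intro x hx
      exfalso
      have h1 := hx.2 ⟨0, hr0⟩
      have h2 := (sp_nonempty (hx.1.1 ⟨0, hr0⟩).1).card_pos
      omega
  have hall : ∀ n, Pn r m k n := by
    intro n
    induction n with
    | zero => exact h0
    | succ n ih => exact step hr hk hm ih
  obtain ⟨g, F', hg, _, _, nF', hgF⟩ := hall (m + 1)
  refine ⟨g, hg, fun x hx => ?_⟩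
  rw [← hgF x ⟨hx, fun i => ?_⟩]
  · exact nF' x hx
  · rw [C_card (hx.1 i)]
    exact (Finset.card_le_univ _).trans (by simp)

end Tv

/-- for `r ≥ 2`, `k ≥ 3`, `m = (r-1)k`, `N = (rk+1)(r-1)`, if there is an
`S_r`-equivariant continuous map `X → S^{m-1}` from the deleted fiber product of the
colorful subcomplex, then there is a continuous map `f : σ^N → ℝ^{rk}` with no
`r`-Tverberg point. -/
theorem statement6 (r k : ℕ) (hr : 2 ≤ r) (hk : 3 ≤ k)
    (m : ℕ) (hm : m = (r - 1) * k)
    (hF : ∃ F : (Fin r → ((Fin r × Fin (m + 1)) → ℝ)) → (Fin r → EuclideanSpace ℝ (Fin k)),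
      ContinuousOn F (deletedFiberProd r m) ∧
      MapsTo F (deletedFiberProd r m) (blockSphere k r) ∧
      ∀ x ∈ deletedFiberProd r m, ∀ π : Equiv.Perm (Fin r),
        F (fun i => x (π i)) = fun i => F x (π i)) :
    ∃ f : ((Fin r × Fin (m + 1)) → ℝ) → EuclideanSpace ℝ (Fin (r * k)),
      ContinuousOn f (stdSimplex ℝ (Fin r × Fin (m + 1))) ∧
      ¬ ∃ x : Fin r → ((Fin r × Fin (m + 1)) → ℝ),
          (∀ i, x i ∈ stdSimplex ℝ (Fin r × Fin (m + 1))) ∧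
          (Pairwise fun i j => Disjoint {v | 0 < x i v} {v | 0 < x j v}) ∧
          (∀ i j, f (x i) = f (x j)) := by
  obtain ⟨F, hFc, hmap, eF⟩ := hF
  obtain ⟨g, hg, hNV⟩ := Tv.main hr hk hm hFc hmap eF
  have hfr : Module.finrank ℝ ((Fin m → ℝ) × EuclideanSpace ℝ (Fin k)) =
      Module.finrank ℝ (EuclideanSpace ℝ (Fin (r * k))) := by
    obtain ⟨r', rfl⟩ : ∃ r', r = r' + 1 := ⟨r - 1, by omega⟩
    simp [hm]
    ring
  let e : ((Fin m → ℝ) × EuclideanSpace ℝ (Fin k)) ≃L[ℝ] EuclideanSpace ℝ (Fin (r * k)) :=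
    ContinuousLinearEquiv.ofFinrankEq hfr
  refine ⟨fun x => e (fun j => simplexProj r m x j.succ, g x), ?_, ?_⟩
  · apply Continuous.continuousOn
    have := Tv.continuous_proj (r := r) (m := m)
    refine e.continuous.comp (Continuous.prodMk ?_ hg)
    exact continuous_pi fun j => (continuous_apply j.succ).comp this
  · rintro ⟨x, hx, hd, heq⟩
    have h1 : ∀ i j, (fun l : Fin m => simplexProj r m (x i) l.succ) =
        (fun l : Fin m => simplexProj r m (x j) l.succ) ∧ g (x i) = g (x j) := fun i j =>
      Prod.ext_iff.1 (e.injective (heq i j))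
    have hp : ∀ i j, simplexProj r m (x i) = simplexProj r m (x j) := by
      intro i j
      rw [← Tv.Yq_tail (Tv.C_proj_mem (hx i)).2, ← Tv.Yq_tail (Tv.C_proj_mem (hx j)).2, (h1 i j).1]
    obtain ⟨i, j, hij⟩ := hNV x (Tv.mem_X_of_simplex hx hd hp)
    exact hij (h1 i j).2
end
end

section
/- Let r ≥ 2 and d ≥ 1, and let K be a finite geometric simplicial complex such that for every r pairwise disjoint faces σ_1,…,σ_r of K one has Σ_{i=1}^r dim σ_i < d(r−1) (i.e., the deleted product K^r_Δ has dimension less than d(r−1)). Then there exists a continuous map f : |K| → ℝ^d with no r-Tverberg point. -/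
open Set

noncomputable section

/-- `s` is a face of `K` containing `x` in its relative interior; i.e. `s` is the
support of `x` in `K`. -/
def IsSupportFace {n : ℕ} (K : Geometry.SimplicialComplex ℝ (EuclideanSpace ℝ (Fin n)))
    (x : EuclideanSpace ℝ (Fin n)) (s : Finset (EuclideanSpace ℝ (Fin n))) : Prop :=
  s ∈ K.faces ∧ x ∈ intrinsicInterior ℝ (convexHull ℝ (↑s : Set (EuclideanSpace ℝ (Fin n))))

/-- The continuous map `f : |K| → ℝ^d` has an `r`-Tverberg point: there are `r` points of
`|K|` with pairwise (vertex-)disjoint supports mapped to the same point. -/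
def HasTverbergPoint {n d : ℕ} (K : Geometry.SimplicialComplex ℝ (EuclideanSpace ℝ (Fin n)))
    (r : ℕ) (f : EuclideanSpace ℝ (Fin n) → EuclideanSpace ℝ (Fin d)) : Prop :=
  ∃ (x : Fin r → EuclideanSpace ℝ (Fin n)) (s : Fin r → Finset (EuclideanSpace ℝ (Fin n))),
    (∀ i, IsSupportFace K (x i) (s i)) ∧
    (Pairwise fun i j => Disjoint (s i) (s j)) ∧
    (∀ i j, f (x i) = f (x j))

/-- The `r`-fold deleted product `K^r_Δ` of `K`, as a subspace of `((ℝ^n))^r`. -/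
def deletedProduct {n : ℕ} (K : Geometry.SimplicialComplex ℝ (EuclideanSpace ℝ (Fin n)))
    (r : ℕ) : Set (Fin r → EuclideanSpace ℝ (Fin n)) :=
  {x | ∃ s : Fin r → Finset (EuclideanSpace ℝ (Fin n)),
    (∀ i, IsSupportFace K (x i) (s i)) ∧ Pairwise fun i j => Disjoint (s i) (s j)}

/-- The sphere `S^{d(r-1)-1} = {(y_1,…,y_r) ∈ (ℝ^d)^r : Σ y_i = 0, Σ ‖y_i‖² = 1}`. -/
def tvSphere (d r : ℕ) : Set (Fin r → EuclideanSpace ℝ (Fin d)) :=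
  {y | (∑ i, y i) = 0 ∧ (∑ i, ‖y i‖ ^ 2) = 1}

/-- There exists an `S_r`-equivariant continuous map `K^r_Δ → S^{d(r-1)-1}`. -/
def ExistsEquivariantMap {n : ℕ} (K : Geometry.SimplicialComplex ℝ (EuclideanSpace ℝ (Fin n)))
    (r d : ℕ) : Prop :=
  ∃ F : (Fin r → EuclideanSpace ℝ (Fin n)) → (Fin r → EuclideanSpace ℝ (Fin d)),
    ContinuousOn F (deletedProduct K r) ∧
    MapsTo F (deletedProduct K r) (tvSphere d r) ∧
    ∀ x ∈ deletedProduct K r, ∀ π : Equiv.Perm (Fin r),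
      F (fun i => x (π i)) = fun i => F x (π i)


/-- Parametrization of the bad configurations. -/
def badParam {V : Type*} [Fintype V] [DecidableEq V] {d r : ℕ}
    (s : Fin r → Finset V) (c : Fin r → V)
    (p : ({v : V // ¬ ∃ i, c i = v} → EuclideanSpace ℝ (Fin d)) ×
      ((Σ i, {v // v ∈ (s i).erase (c i)}) → ℝ) × EuclideanSpace ℝ (Fin d)) :
    V → EuclideanSpace ℝ (Fin d) := by
  classical
  exact fun v =>
    if h : ∃ i, c i = v then
      p.2.2 + ∑ w : {v // v ∈ (s h.choose).erase (c h.choose)},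
        p.2.1 ⟨h.choose, w⟩ •
          ((if h' : ¬ ∃ i, c i = (w : V) then p.1 ⟨w, h'⟩ else 0) - p.2.2)
    else p.1 ⟨v, h⟩

lemma badParam_contDiff {V : Type*} [Fintype V] [DecidableEq V] {d r : ℕ}
    (s : Fin r → Finset V) (c : Fin r → V) :
    ContDiff ℝ 1 (badParam (d := d) s c) := by
  rw [contDiff_pi]
  intro v
  unfold badParam
  by_cases h : ∃ i, c i = v
  · simp only [dif_pos h]
    refine ContDiff.add (by fun_prop) (ContDiff.sum fun w _ => ?_)
    by_cases h' : ¬ ∃ i, c i = (w : V)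
    · simp only [dif_pos h']
      fun_prop
    · simp only [dif_neg h']
      fun_prop
  · simp only [dif_neg h]
    exact (contDiff_pi.1 contDiff_fst _)

/-- The index of a bad configuration. -/
def GoodIdx {V : Type*} [DecidableEq V] (d : ℕ) {r : ℕ}
    (p : (Fin r → Finset V) × (Fin r → V)) : Prop :=
  (∀ i, p.2 i ∈ p.1 i) ∧ (Pairwise fun i j => Disjoint (p.1 i) (p.1 j)) ∧
    (∑ i, ((p.1 i).card - 1)) < d * (r - 1)

lemma GoodIdx.inj {V : Type*} [DecidableEq V] {d r : ℕ}
    {p : (Fin r → Finset V) × (Fin r → V)} (hp : GoodIdx d p) : Function.Injective p.2 := by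
  intro i j hij
  by_contra hne
  exact Finset.disjoint_left.1 (hp.2.1 hne) (hp.1 i) (hij ▸ hp.1 j)

lemma badParam_dimH {V : Type*} [Fintype V] [DecidableEq V] {d r : ℕ} (hr : 1 ≤ r)
    (p : (Fin r → Finset V) × (Fin r → V)) (hp : GoodIdx d p) :
    dimH (range (badParam (d := d) p.1 p.2)) < ((d * Fintype.card V : ℕ) : ENNReal) := by
  classical
  refine (badParam_contDiff (d := d) p.1 p.2).dimH_range_le.trans_lt (Nat.cast_lt.2 ?_)
  have hc : Fintype.card {v : V // ¬ ∃ i, p.2 i = v} + r = Fintype.card V := by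
    have h1 := Fintype.card_subtype_compl (fun v : V => ∃ i, p.2 i = v)
    have h2 : Fintype.card {v : V // ∃ i, p.2 i = v} = r := by
      have := Fintype.card_congr (Equiv.ofInjective p.2 hp.inj)
      rw [Fintype.card_fin] at this
      refine Eq.trans ?_ this.symm
      exact Fintype.card_congr (Equiv.subtypeEquivRight fun v => Iff.rfl)
    have h3 := Fintype.card_subtype_le (fun v : V => ∃ i, p.2 i = v)
    rw [h2] at h1 h3
    have h4 : Fintype.card {v : V // ¬ ∃ i, p.2 i = v} = Fintype.card V - r := by
      rw [← h1]
    omega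
  have hm : Fintype.card (Σ i, {v // v ∈ (p.1 i).erase (p.2 i)}) = ∑ i, ((p.1 i).card - 1) := by
    rw [Fintype.card_sigma]
    refine Finset.sum_congr rfl fun i _ => ?_
    rw [Fintype.card_coe, Finset.card_erase_of_mem (hp.1 i)]
  rw [Module.finrank_prod, Module.finrank_prod, Module.finrank_pi_fintype,
    Module.finrank_fintype_fun_eq_card, hm]
  simp only [finrank_euclideanSpace_fin, Finset.sum_const, Finset.card_univ, smul_eq_mul]
  have := hp.2.2
  obtain ⟨q, rfl⟩ : ∃ q, r = q + 1 := ⟨r - 1, by omega⟩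
  rw [← hc]
  simp only [Nat.add_sub_cancel] at this
  generalize Fintype.card {v : V // ¬ ∃ i, p.2 i = v} = a at *
  nlinarith

lemma mem_range_badParam {V : Type*} [Fintype V] [DecidableEq V] {d r : ℕ}
    (p : (Fin r → Finset V) × (Fin r → V)) (hp : GoodIdx d p)
    (g : V → EuclideanSpace ℝ (Fin d)) (w : Fin r → V → ℝ)
    (hw : ∀ i, w i (p.2 i) ≠ 0) (hw1 : ∀ i, ∑ v ∈ p.1 i, w i v = 1)
    (y : EuclideanSpace ℝ (Fin d)) (hy : ∀ i, ∑ v ∈ p.1 i, w i v • g v = y) :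
    g ∈ range (badParam (d := d) p.1 p.2) := by
  classical
  refine ⟨(fun v => g v, fun m => - (w m.1 m.2 / w m.1 (p.2 m.1)), y), ?_⟩
  funext v
  unfold badParam
  by_cases h : ∃ i, p.2 i = v
  · simp only [dif_pos h]
    have hcv := h.choose_spec
    generalize h.choose = i at hcv
    subst hcv
    have hg : ∀ u : {v // v ∈ (p.1 i).erase (p.2 i)},
        (if h' : ¬ ∃ j, p.2 j = (u : V) then g u else 0) = g u := by
      rintro ⟨u, hu⟩
      rw [dif_pos]
      rintro ⟨j, hj⟩
      simp only at hj
      subst hj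
      rw [Finset.mem_erase] at hu
      refine Finset.disjoint_left.1 (hp.2.1 (i := i) (j := j) ?_) hu.2 (hp.1 j)
      rintro rfl
      exact hu.1 rfl
    simp only [hg]
    rw [Finset.sum_coe_sort ((p.1 i).erase (p.2 i))
      (fun u => -(w i u / w i (p.2 i)) • (g u - y))]
    have e1 := hw1 i
    have e2 := hy i
    rw [← Finset.add_sum_erase _ _ (hp.1 i)] at e1 e2
    have h0 : ∑ u ∈ (p.1 i).erase (p.2 i), w i u • (g u - y)
        = - (w i (p.2 i) • (g (p.2 i) - y)) := by
      simp only [smul_sub, Finset.sum_sub_distrib, ← Finset.sum_smul]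
      rw [eq_sub_of_add_eq' e1, eq_sub_of_add_eq' e2]
      module
    have h1 : ∑ u ∈ (p.1 i).erase (p.2 i), -(w i u / w i (p.2 i)) • (g u - y)
        = -(w i (p.2 i))⁻¹ • ∑ u ∈ (p.1 i).erase (p.2 i), w i u • (g u - y) := by
      rw [Finset.smul_sum]
      refine Finset.sum_congr rfl fun u _ => ?_
      rw [smul_smul]
      congr 1
      ring
    rw [h1, h0, neg_smul_neg, smul_smul, inv_mul_cancel₀ (hw i), one_smul]
    abel
  · simp only [dif_neg h]

lemma exists_generic (V : Type*) [Fintype V] [DecidableEq V] (d r : ℕ) (hr : 1 ≤ r) :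
    ∃ g : V → EuclideanSpace ℝ (Fin d), ∀ s : Fin r → Finset V,
      (Pairwise fun i j => Disjoint (s i) (s j)) →
      (∑ i, ((s i).card - 1)) < d * (r - 1) →
      ∀ w : Fin r → V → ℝ, (∀ i, ∑ v ∈ s i, w i v = 1) →
      ∀ y, ¬ ∀ i, ∑ v ∈ s i, w i v • g v = y := by
  classical
  obtain ⟨g, hg⟩ : ∃ g : V → EuclideanSpace ℝ (Fin d),
      ∀ p : (Fin r → Finset V) × (Fin r → V), GoodIdx d p →
        g ∉ range (badParam (d := d) p.1 p.2) := by
    rcases Nat.eq_zero_or_pos (d * Fintype.card V) with h0 | h0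
    · refine ⟨0, fun p hp => ?_⟩
      have := badParam_dimH hr p hp
      rw [h0] at this
      simp at this
    · have key : dimH (⋃ p ∈ (Finset.univ.filter (GoodIdx d) :
          Finset ((Fin r → Finset V) × (Fin r → V))), range (badParam (d := d) p.1 p.2))
          < (Module.finrank ℝ (V → EuclideanSpace ℝ (Fin d)) : ENNReal) := by
        have hfr : Module.finrank ℝ (V → EuclideanSpace ℝ (Fin d)) = d * Fintype.card V := by
          rw [Module.finrank_pi_fintype]
          simp [mul_comm]
        rw [hfr]
        have := dimH_bUnion (Finset.countable_toSet (Finset.univ.filter (GoodIdx d) :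
          Finset ((Fin r → Finset V) × (Fin r → V))))
          (fun p => range (badParam (d := d) p.1 p.2))
        simp only [Finset.mem_coe] at this
        rw [this, ← Finset.sup_eq_iSup, Finset.sup_lt_iff (by simpa using h0)]
        intro p hp
        exact badParam_dimH hr p (Finset.mem_filter.1 hp).2
      obtain ⟨g, hg⟩ := (dense_compl_of_dimH_lt_finrank key).nonempty
      refine ⟨g, fun p hp hgp => hg ?_⟩
      exact mem_biUnion (x := p) (by simpa using hp) hgp
  refine ⟨g, fun s hs hdim w hw y hy => ?_⟩
  have hc : ∀ i, ∃ v ∈ s i, w i v ≠ 0 := fun i =>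
    Finset.exists_ne_zero_of_sum_ne_zero (by rw [hw i]; exact one_ne_zero)
  choose c hc hc0 using hc
  exact hg (s, c) ⟨hc, hs, hdim⟩ (mem_range_badParam (s, c) ⟨hc, hs, hdim⟩ g w hc0 hw y hy)

lemma exists_generic' {E : Type*} [DecidableEq E] (V : Finset E) (d r : ℕ) (hr : 1 ≤ r) :
    ∃ g : E → EuclideanSpace ℝ (Fin d), ∀ s : Fin r → Finset E, (∀ i, s i ⊆ V) →
      (Pairwise fun i j => Disjoint (s i) (s j)) →
      (∑ i, ((s i).card - 1)) < d * (r - 1) →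
      ∀ w : Fin r → E → ℝ, (∀ i, ∑ v ∈ s i, w i v = 1) →
      ∀ y, ¬ ∀ i, ∑ v ∈ s i, w i v • g v = y := by
  classical
  obtain ⟨g, hg⟩ := exists_generic {v // v ∈ V} d r hr
  refine ⟨fun v => if h : v ∈ V then g ⟨v, h⟩ else 0, fun s hsV hs hdim w hw y hy => ?_⟩
  have hmap : ∀ i, ((s i).subtype (· ∈ V)).map (Function.Embedding.subtype _) = s i := by
    intro i
    rw [Finset.subtype_map]
    exact Finset.filter_true_of_mem fun v hv => hsV i hv
  refine hg (fun i => (s i).subtype (· ∈ V)) ?_ ?_ (fun i v => w i v) ?_ y ?_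
  · intro i j hij
    rw [Finset.disjoint_left]
    intro a ha hb
    exact Finset.disjoint_left.1 (hs hij) (Finset.mem_subtype.1 ha) (Finset.mem_subtype.1 hb)
  · convert hdim using 3 with i
    rw [← hmap i, Finset.card_map, hmap i]
  · intro i
    rw [← hw i]
    conv_rhs => rw [← hmap i, Finset.sum_map]
    rfl
  · intro i
    rw [← hy i]
    conv_rhs => rw [← hmap i, Finset.sum_map]
    refine Finset.sum_congr rfl fun v _ => ?_
    simp

lemma exists_affine_ext {E F : Type*} [AddCommGroup E] [Module ℝ E] [AddCommGroup F] [Module ℝ F]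
    (s : Finset E) (hs : AffineIndependent ℝ ((↑) : s → E)) (g : E → F) :
    ∃ (L : E →ₗ[ℝ] F) (b : F), ∀ v ∈ s, L v + b = g v := by
  rcases s.eq_empty_or_nonempty with rfl | ⟨p, hp⟩
  · exact ⟨0, 0, by simp⟩
  rw [affineIndependent_iff_linearIndependent_vsub ℝ _ (⟨p, hp⟩ : s)] at hs
  obtain ⟨L, hL⟩ := LinearMap.exists_extend
    ((Module.Basis.span hs).constr ℝ (fun i => g i.1 - g p))
  have hLv : ∀ v (hv : v ∈ s), v ≠ p → L (v - p) = g v - g p := by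
    intro v hv hvp
    have h1 := (Module.Basis.span hs).constr_basis ℝ (fun i => g i.1 - g p)
      ⟨⟨v, hv⟩, by simpa [Subtype.ext_iff] using hvp⟩
    rw [← hL] at h1
    simpa [Module.Basis.span_apply] using h1
  refine ⟨L, g p - L p, fun v hv => ?_⟩
  by_cases hvp : v = p
  · subst hvp; abel
  · have := hLv v hv hvp
    rw [map_sub] at this
    rw [← sub_eq_zero] at this ⊢
    rw [← this]; abel

lemma affine_sum {E F : Type*} [AddCommGroup E] [Module ℝ E] [AddCommGroup F] [Module ℝ F]
    (s : Finset E) (g : E → F) (L : E →ₗ[ℝ] F) (b : F) (h : ∀ v ∈ s, L v + b = g v)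
    (w : E → ℝ) (hw : ∑ v ∈ s, w v = 1) :
    L (∑ v ∈ s, w v • v) + b = ∑ v ∈ s, w v • g v := by
  rw [map_sum, ← one_smul ℝ b, ← hw, Finset.sum_smul, ← Finset.sum_add_distrib]
  refine Finset.sum_congr rfl fun v hv => ?_
  rw [← h v hv, map_smul, smul_add]

/-- if the deleted product of `K` has dimension less than `d(r-1)`,
i.e. every `r` pairwise disjoint faces `σ_1,…,σ_r` of `K` satisfy
`Σ dim σ_i < d(r-1)`, then there is a continuous map `|K| → ℝ^d` without
`r`-Tverberg points. -/
theorem statement16 (n d r : ℕ) (hr : 2 ≤ r) (hd : 1 ≤ d)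
    (K : Geometry.SimplicialComplex ℝ (EuclideanSpace ℝ (Fin n)))
    (hK : K.faces.Finite)
    (hdim : ∀ s : Fin r → Finset (EuclideanSpace ℝ (Fin n)),
      (∀ i, s i ∈ K.faces) → (Pairwise fun i j => Disjoint (s i) (s j)) →
      (∑ i, ((s i).card - 1)) < d * (r - 1)) :
    ∃ f : EuclideanSpace ℝ (Fin n) → EuclideanSpace ℝ (Fin d),
      ContinuousOn f K.space ∧ ¬ HasTverbergPoint K r f := by
  classical
  have hVfin : (⋃ k ∈ K.faces, (k : Set (EuclideanSpace ℝ (Fin n)))).Finite :=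
    hK.biUnion fun k _ => k.finite_toSet
  obtain ⟨g, hg⟩ := exists_generic' hVfin.toFinset d r (by omega)
  have hA := fun (k : K.faces) => exists_affine_ext k.1 (K.indep k.2) g
  choose L b hLb using hA
  have hex : ∀ x : EuclideanSpace ℝ (Fin n), ∃ k : Option K.faces, x ∈ K.space →
      ∃ k', k = some k' ∧ x ∈ convexHull ℝ (k'.1 : Set (EuclideanSpace ℝ (Fin n))) := by
    intro x
    by_cases hx : x ∈ K.space
    · obtain ⟨s, hs, hxs⟩ := Geometry.SimplicialComplex.mem_space_iff.1 hx
      exact ⟨some ⟨s, hs⟩, fun _ => ⟨_, rfl, hxs⟩⟩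
    · exact ⟨none, fun h => absurd h hx⟩
  choose φ hφ using hex
  set f : EuclideanSpace ℝ (Fin n) → EuclideanSpace ℝ (Fin d) :=
    fun x => (φ x).elim 0 (fun k => L k x + b k) with hf
  have hfeq : ∀ (k : K.faces) (x), x ∈ convexHull ℝ (k.1 : Set (EuclideanSpace ℝ (Fin n))) →
      f x = L k x + b k := by
    intro k x hx
    obtain ⟨k', hk', hx'⟩ := hφ x (Geometry.SimplicialComplex.convexHull_subset_space k.2 hx)
    simp only [hf, hk', Option.elim_some]
    have hx2 := K.inter_subset_convexHull k.2 k'.2 ⟨hx, hx'⟩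
    rw [← Finset.coe_inter, Finset.mem_convexHull'] at hx2
    obtain ⟨w, -, hw, rfl⟩ := hx2
    rw [affine_sum _ g (L k) (b k) (fun v hv => hLb k v (Finset.mem_inter.1 hv).1) w hw,
      affine_sum _ g (L k') (b k') (fun v hv => hLb k' v (Finset.mem_inter.1 hv).2) w hw]
  refine ⟨f, ?_, ?_⟩
  · have hsp : K.space = ⋃ k : K.faces, convexHull ℝ (k.1 : Set (EuclideanSpace ℝ (Fin n))) := by
      rw [Geometry.SimplicialComplex.space, biUnion_eq_iUnion]
    have : Finite K.faces := hK
    rw [hsp]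
    refine (locallyFinite_of_finite _).continuousOn_iUnion
      (fun k => (k.1.finite_toSet.isClosed_convexHull ℝ)) fun k => ?_
    refine ContinuousOn.congr ?_ (fun x hx => hfeq k x hx)
    exact ((L k).continuous_of_finiteDimensional.add continuous_const).continuousOn
  · rintro ⟨x, s, hs, hdis, hfx⟩
    have hw : ∀ i, ∃ w : EuclideanSpace ℝ (Fin n) → ℝ, ∑ v ∈ s i, w v = 1 ∧
        ∑ v ∈ s i, w v • g v = f (x i) := by
      intro i
      have hx := intrinsicInterior_subset (hs i).2
      have h1 := hfeq ⟨s i, (hs i).1⟩ (x i) hx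
      rw [Finset.mem_convexHull'] at hx
      obtain ⟨w, -, hw, hwx⟩ := hx
      refine ⟨w, hw, ?_⟩
      have h2 := affine_sum _ g _ _ (hLb ⟨s i, (hs i).1⟩) w hw
      exact h2.symm.trans ((congrArg (fun z => L ⟨s i, (hs i).1⟩ z + b ⟨s i, (hs i).1⟩) hwx).trans
        h1.symm)
    choose w hw1 hw2 using hw
    refine hg s ?_ hdis (hdim s (fun i => (hs i).1) hdis) w hw1 (f (x ⟨0, by omega⟩)) ?_
    · intro i v hv
      rw [Set.Finite.mem_toFinset]
      exact mem_biUnion (hs i).1 hv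
    · intro i
      rw [hw2 i]
      exact hfx _ _
end
end
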